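/- arXiv:0907.2260 — 3 statements merged into one kernel-verified Lean document; each statement's English description precedes it below -/
import Mathlib

section
/- If a symmetric matrix polynomial f ∈ ℝ[X₁,…,Xₙ]^{t×t} satisfies f(x) ⪰ 0 for all x ∈ ℝⁿ, then there exists a nonzero polynomial p ∈ ℝ[X₁,…,Xₙ] such that p²f is a sum of hermitian squares in ℝ[X̄]^{t×t}. Conversely, if p²f is a sum of hermitian squares for some nonzero p, then f(x) ⪰ 0 for all x ∈ ℝⁿ. -/
open Matrix

/-- Sum of hermitian squares in `ℝ[X̄]^{t×t}`. -/
def IsSOHS (n t : ℕ) (A : Matrix (Fin t) (Fin t) (MvPolynomial (Fin n) ℝ)) : Prop :=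
  ∃ (N : ℕ) (B : Fin N → Matrix (Fin t) (Fin t) (MvPolynomial (Fin n) ℝ)),
    A = ∑ i, (B i)ᵀ * B i

section RealAlgebra

open Polynomial

/-- The intermediate value property for polynomials over an ordered field. -/
def HasPolynomialIVT (R : Type*) [Field R] [LinearOrder R] : Prop :=
  ∀ (f : R[X]) (a b : R), a < b → f.eval a * f.eval b < 0 → ∃ c ∈ Set.Ioo a b, f.eval c = 0

namespace HasPolynomialIVT

variable {R : Type*} [Field R] [LinearOrder R]

theorem exists_eval_eq (hR : HasPolynomialIVT R) {f : R[X]} {a b y : R} (hab : a < b)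
    (h : (f.eval a - y) * (f.eval b - y) < 0) : ∃ c ∈ Set.Ioo a b, f.eval c = y := by
  obtain ⟨c, hc, h0⟩ := hR (f - C y) a b hab (by simpa using h)
  exact ⟨c, hc, by simpa [sub_eq_zero] using h0⟩

variable [IsStrictOrderedRing R]

theorem sign_eval_eq (hR : HasPolynomialIVT R) {f : R[X]} {s : Set R} (hs : s.OrdConnected)
    (hf : ∀ x ∈ s, f.eval x ≠ 0) {x y : R} (hx : x ∈ s) (hy : y ∈ s) :
    SignType.sign (f.eval x) = SignType.sign (f.eval y) := by
  wlog hxy : x < y generalizing x y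
  · rcases eq_or_lt_of_le (not_lt.1 hxy) with rfl | h
    · rfl
    · exact (this hy hx h).symm
  by_contra hne
  have hneg : f.eval x * f.eval y < 0 := by
    rcases lt_or_gt_of_ne (hf x hx) with h1 | h1 <;> rcases lt_or_gt_of_ne (hf y hy) with h2 | h2
    · exact absurd (by rw [sign_neg h1, sign_neg h2]) hne
    · exact mul_neg_of_neg_of_pos h1 h2
    · exact mul_neg_of_pos_of_neg h1 h2
    · exact absurd (by rw [sign_pos h1, sign_pos h2]) hne
  obtain ⟨c, hc, h0⟩ := hR f x y hxy hneg
  exact hf c (hs.out hx hy ⟨hc.1.le, hc.2.le⟩) h0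

/-- Rolle's theorem between two consecutive roots. -/
theorem exists_derivative_eq_zero_of_consecutive (hR : HasPolynomialIVT R) {f : R[X]} (hf : f ≠ 0)
    {a b : R} (hab : a < b) (ha : f.eval a = 0) (hb : f.eval b = 0)
    (hroot : ∀ x ∈ Set.Ioo a b, f.eval x ≠ 0) :
    ∃ c ∈ Set.Ioo a b, (derivative f).eval c = 0 := by
  obtain ⟨q, hq, hqa⟩ := exists_eq_pow_rootMultiplicity_mul_and_not_dvd f hf a
  have hm : 0 < rootMultiplicity a f := (rootMultiplicity_pos hf).2 ha
  have hq0 : q ≠ 0 := by rintro rfl; simp at hqa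
  have hqb : q.eval b = 0 := by
    rw [hq] at hb
    simpa [sub_eq_zero, hab.ne', hm.ne'] using hb
  obtain ⟨h, hh, hhb⟩ := exists_eq_pow_rootMultiplicity_mul_and_not_dvd q hq0 b
  have hn : 0 < rootMultiplicity b q := (rootMultiplicity_pos hq0).2 hqb
  obtain ⟨m, hm'⟩ := Nat.exists_eq_succ_of_ne_zero hm.ne'
  obtain ⟨n, hn'⟩ := Nat.exists_eq_succ_of_ne_zero hn.ne'
  rw [hm'] at hq
  rw [hn'] at hh
  have hfac : f = (X - C a) ^ (m + 1) * ((X - C b) ^ (n + 1) * h) := by rw [← hh]; exact hq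
  have hha : h.eval a ≠ 0 := by
    intro h0
    apply hqa
    rw [dvd_iff_isRoot, IsRoot.def, hh]
    simp [h0]
  have hhb' : h.eval b ≠ 0 := fun h0 => hhb (dvd_iff_isRoot.2 h0)
  have hpos : 0 < h.eval a * h.eval b := by
    by_contra hle
    have hneg : h.eval a * h.eval b < 0 :=
      lt_of_le_of_ne (not_lt.1 hle) (mul_ne_zero hha hhb')
    obtain ⟨c, hc, h0⟩ := hR h a b hab hneg
    exact hroot c hc (by rw [hfac]; simp [h0])
  set g : R[X] := C ((m : R) + 1) * (X - C b) * h + C ((n : R) + 1) * (X - C a) * h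
    + (X - C a) * (X - C b) * derivative h with hg
  have hder : derivative f = (X - C a) ^ m * (X - C b) ^ n * g := by
    rw [hfac, hg]
    simp only [derivative_mul, derivative_X_sub_C_pow, Nat.cast_add, Nat.cast_one,
      Nat.add_sub_cancel, C_add, C_1, map_natCast]
    ring
  have hgneg : g.eval a * g.eval b < 0 := by
    have : g.eval a * g.eval b
        = -(((m : R) + 1) * ((n : R) + 1) * (b - a) ^ 2 * (h.eval a * h.eval b)) := by
      simp [hg]; ring
    rw [this]
    have := sub_pos.2 hab
    exact neg_neg_of_pos (by positivity)
  obtain ⟨c, hc, h0⟩ := hR g a b hab hgneg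
  exact ⟨c, hc, by rw [hder]; simp [h0]⟩

/-- Rolle's theorem. -/
theorem exists_derivative_eq_zero (hR : HasPolynomialIVT R) {f : R[X]} {a b : R} (hab : a < b)
    (h : f.eval a = f.eval b) : ∃ c ∈ Set.Ioo a b, (derivative f).eval c = 0 := by
  by_cases hf : f - C (f.eval a) = 0
  · obtain ⟨c, hc⟩ := exists_between hab
    refine ⟨c, hc, ?_⟩
    rw [sub_eq_zero.1 hf]
    simp
  set g := f - C (f.eval a) with hg
  have hga : g.eval a = 0 := by simp [hg]
  have hgb : g.eval b = 0 := by simp [hg, h]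
  let Z := g.roots.toFinset.filter (a < ·)
  have hb : b ∈ Z := by simp [Z, hf, hab, hgb]
  obtain ⟨b', hb', hmin⟩ := Z.exists_min_image id ⟨b, hb⟩
  have hb'1 : a < b' := (Finset.mem_filter.1 hb').2
  have hb'2 : g.eval b' = 0 := by
    have := (Finset.mem_filter.1 hb').1
    simpa [hf] using this
  obtain ⟨c, hc, h0⟩ := hR.exists_derivative_eq_zero_of_consecutive hf hb'1 hga hb'2 (by
    intro x hx h0
    have : x ∈ Z := by simp [Z, hf, hx.1, h0]
    exact absurd (hmin x this) (not_le.2 hx.2))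
  exact ⟨c, ⟨hc.1, hc.2.trans_le (hmin b hb)⟩, by simpa [hg] using h0⟩

theorem injOn_eval (hR : HasPolynomialIVT R) {f : R[X]} {a b : R}
    (hf : ∀ x ∈ Set.Ioo a b, (derivative f).eval x ≠ 0) :
    Set.InjOn (fun x => f.eval x) (Set.Icc a b) := by
  intro x hx y hy hxy
  wlog h : x < y generalizing x y
  · rcases eq_or_lt_of_le (not_lt.1 h) with h | h
    · exact h.symm
    · exact (this hy hx hxy.symm h).symm
  obtain ⟨c, hc, h0⟩ := hR.exists_derivative_eq_zero h hxy
  exact absurd h0 (hf c ⟨hx.1.trans_lt hc.1, hc.2.trans_le hy.2⟩)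

theorem eval_mul_eval_neg (hR : HasPolynomialIVT R) {f : R[X]} {a b x : R}
    (hf : ∀ x ∈ Set.Ioo a b, (derivative f).eval x ≠ 0) (hx : x ∈ Set.Ioo a b)
    (h0 : f.eval x = 0) : f.eval a * f.eval b < 0 := by
  have hinj := hR.injOn_eval hf
  have hab : a < b := hx.1.trans hx.2
  have hIa : a ∈ Set.Icc a b := ⟨le_rfl, hab.le⟩
  have hIb : b ∈ Set.Icc a b := ⟨hab.le, le_rfl⟩
  have hIx : x ∈ Set.Icc a b := ⟨hx.1.le, hx.2.le⟩
  have ha : f.eval a ≠ 0 := fun h => hx.1.ne (hinj hIa hIx (h.trans h0.symm))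
  have hb : f.eval b ≠ 0 := fun h => hx.2.ne' (hinj hIb hIx (h.trans h0.symm))
  have hne : f.eval a ≠ f.eval b := fun h => hab.ne (hinj hIa hIb h)
  by_contra hcon
  have hpos : 0 < f.eval a * f.eval b :=
    lt_of_le_of_ne (not_lt.1 hcon) (mul_ne_zero ha hb).symm
  -- one of the two end values lies strictly between `0` and the other one
  have key : f.eval a * (f.eval a - f.eval b) < 0 ∨ f.eval b * (f.eval b - f.eval a) < 0 := by
    rcases lt_or_gt_of_ne ha with h1 | h1 <;> rcases lt_or_gt_of_ne hb with h2 | h2 <;>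
      rcases lt_or_gt_of_ne hne with h3 | h3 <;>
      first
        | (left; nlinarith)
        | (right; nlinarith)
  rcases key with h | h
  · obtain ⟨c, hc, he⟩ := hR.exists_eval_eq (f := f) (y := f.eval a) hx.2 (by rw [h0]; nlinarith)
    exact (hx.1.trans hc.1).ne' (hinj ⟨(hx.1.trans hc.1).le, hc.2.le⟩ hIa he)
  · obtain ⟨c, hc, he⟩ := hR.exists_eval_eq (f := f) (y := f.eval b) hx.1 (by rw [h0]; nlinarith)
    exact (hc.2.trans hx.2).ne (hinj ⟨hc.1.le, (hc.2.trans hx.2).le⟩ hIb he)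

end HasPolynomialIVT

theorem sign_apply_of_strictMono {K R : Type*} [Ring K] [LinearOrder K] [Ring R] [LinearOrder R]
    {π : K →+* R} (hπ : StrictMono π) (k : K) : SignType.sign (π k) = SignType.sign k := by
  rcases lt_trichotomy k 0 with h | rfl | h
  · rw [sign_neg h, sign_neg (by simpa using hπ h)]
  · simp
  · rw [sign_pos h, sign_pos (by simpa using hπ h)]

theorem abs_apply_of_strictMono {K R : Type*} [Ring K] [LinearOrder K] [IsStrictOrderedRing K]
    [Ring R] [LinearOrder R] [IsStrictOrderedRing R]
    {π : K →+* R} (hπ : StrictMono π) (k : K) : π |k| = |π k| := by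
  rcases le_total 0 k with h | h
  · rw [abs_of_nonneg h, abs_of_nonneg (by simpa using hπ.monotone h)]
  · rw [abs_of_nonpos h, abs_of_nonpos (by simpa using hπ.monotone h), map_neg]

theorem eval_map_apply_eq {K R : Type*} [CommSemiring K] [CommSemiring R] (π : K →+* R) (f : K[X])
    (k : K) : (f.map π).eval (π k) = π (f.eval k) := by
  rw [eval_map, eval₂_at_apply]

theorem eval_map_mod {K R : Type*} [Field K] [CommRing R] (π : K →+* R) {f : K[X]} (g : K[X])
    {x : R} (hx : (f.map π).eval x = 0) : (g.map π).eval x = ((g % f).map π).eval x := by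
  conv_lhs => rw [← EuclideanDomain.div_add_mod g f]
  simp [hx]

theorem exists_Ioo_avoiding {K R : Type*} [LinearOrder K] [LinearOrder R] {π : K → R}
    (hπ : StrictMono π) {α : R} (hα : ∀ k, π k ≠ α)
    {a₀ b₀ : K} (ha₀ : π a₀ < α) (hb₀ : α < π b₀) (Z : Finset K) :
    ∃ a b, a₀ ≤ a ∧ b ≤ b₀ ∧ π a < α ∧ α < π b ∧ ∀ z ∈ Z, z ∉ Set.Ioo a b := by
  classical
  induction Z using Finset.induction_on with
  | empty => exact ⟨a₀, b₀, le_rfl, le_rfl, ha₀, hb₀, by simp⟩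
  | insert z Z _ ih =>
    obtain ⟨a, b, h1, h2, h3, h4, h5⟩ := ih
    rcases lt_or_gt_of_ne (hα z) with h | h
    · refine ⟨max a z, b, h1.trans (le_max_left _ _), h2, ?_, h4, ?_⟩
      · rw [hπ.monotone.map_max]
        exact max_lt h3 h
      · intro w hw hw'
        rcases Finset.mem_insert.1 hw with rfl | hw
        · exact (le_max_right a w).not_gt hw'.1
        · exact h5 w hw ⟨(le_max_left _ _).trans_lt hw'.1, hw'.2⟩
    · refine ⟨a, min b z, h1, (min_le_left _ _).trans h2, h3, ?_, ?_⟩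
      · rw [hπ.monotone.map_min]
        exact lt_min h4 h
      · intro w hw hw'
        rcases Finset.mem_insert.1 hw with rfl | hw
        · exact (min_le_right b w).not_gt hw'.2
        · exact h5 w hw ⟨hw'.1, hw'.2.trans_le (min_le_left _ _)⟩

section RelativeClosure

variable {K R₁ R₂ : Type*} [Field K] [LinearOrder K] [Field R₁] [LinearOrder R₁]
  [Field R₂] [LinearOrder R₂]

theorem eval_map_ne_zero_of_roots_notMem {π : K →+* R₁} (hπ : StrictMono π) {g : K[X]}
    (hg : g ≠ 0) (hroots : ∀ x, (g.map π).eval x = 0 → ∃ k, π k = x) {a b : K}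
    (h : ∀ z ∈ g.roots.toFinset, z ∉ Set.Ioo a b) :
    ∀ x ∈ Set.Ioo (π a) (π b), (g.map π).eval x ≠ 0 := by
  intro x hx h0
  obtain ⟨k, rfl⟩ := hroots x h0
  rw [eval_map_apply_eq, map_eq_zero] at h0
  exact h k (by simp [hg, h0]) ⟨hπ.lt_iff_lt.1 hx.1, hπ.lt_iff_lt.1 hx.2⟩

theorem eval_mul_eval_neg_iff {π : K →+* R₁} (hπ : StrictMono π) (f : K[X]) (a b : K) :
    (f.map π).eval (π a) * (f.map π).eval (π b) < 0 ↔ f.eval a * f.eval b < 0 := by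
  rw [eval_map_apply_eq, eval_map_apply_eq, ← map_mul, ← map_zero π, hπ.lt_iff_lt]

variable [IsStrictOrderedRing K] [IsStrictOrderedRing R₁] [IsStrictOrderedRing R₂]

/-- A root of a polynomial over an ordered subfield is bounded by an element of the subfield. -/
theorem exists_abs_lt_of_root {π : K →+* R₁} (hπ : StrictMono π) {f : K[X]} (hf : f ≠ 0) {α : R₁}
    (hα : (f.map π).eval α = 0) : ∃ k, |α| < π k := by
  by_contra! hk
  have hk' : ∀ k, π k < |α| := fun k => (hπ (lt_add_one k)).trans_le (hk (k + 1))
  have key : ∀ n, ∀ g : K[X], g.natDegree = n + 1 → ∀ k, π k < |(g.map π).eval α| := by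
    intro n
    induction n with
    | zero =>
      intro g hg k
      obtain ⟨e, he, c, rfl⟩ := natDegree_eq_one.1 hg
      have he' : 0 < |e| := abs_pos.2 he
      have h1 := hk' ((k + |c|) / |e|)
      rw [map_div₀, div_lt_iff₀ (by simpa using hπ he'), map_add, abs_apply_of_strictMono hπ,
        abs_apply_of_strictMono hπ] at h1
      have h2 := abs_sub_abs_le_abs_sub (π e * α) (-π c)
      simp only [abs_mul, abs_neg, sub_neg_eq_add] at h2
      simp only [Polynomial.map_add, Polynomial.map_mul, map_C, map_X, eval_add, eval_mul, eval_C,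
        eval_X]
      nlinarith
    | succ n ih =>
      intro g hg k
      have hd : g.divX.natDegree = n + 1 := by rw [natDegree_divX_eq_natDegree_tsub_one, hg]; rfl
      have h1 := ih _ hd 1
      rw [map_one] at h1
      set c := g.coeff 0 with hc
      have h3 := hk' (k + |c|)
      rw [map_add, abs_apply_of_strictMono hπ] at h3
      have h2 := abs_sub_abs_le_abs_sub ((g.divX.map π).eval α * α) (-π c)
      simp only [abs_mul, abs_neg, sub_neg_eq_add] at h2
      rw [← divX_mul_X_add g]
      simp only [Polynomial.map_add, Polynomial.map_mul, map_C, map_X, eval_add, eval_mul, eval_C,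
        eval_X]
      have := abs_nonneg α
      nlinarith
  rcases Nat.eq_zero_or_pos f.natDegree with h | h
  · rw [eq_C_of_natDegree_eq_zero h] at hα hf
    simp at hα
    simp [hα] at hf
  · have := key (f.natDegree - 1) f (by omega) 0
    rw [hα] at this
    simp at this

theorem root_mem_range_of_lt {π₁ : K →+* R₁} {π₂ : K →+* R₂}
    (h₁ : HasPolynomialIVT R₁) (h₂ : HasPolynomialIVT R₂)
    (hπ₁ : StrictMono π₁) (hπ₂ : StrictMono π₂)
    (hmax : ∀ α β, (∀ g : K[X], SignType.sign ((g.map π₁).eval α) =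
      SignType.sign ((g.map π₂).eval β)) → ∃ k, π₁ k = α ∧ π₂ k = β)
    {f : K[X]} (hf : f ≠ 0)
    (ih₁ : ∀ g : K[X], g ≠ 0 → g.natDegree < f.natDegree →
      ∀ x, (g.map π₁).eval x = 0 → ∃ k, π₁ k = x)
    (ih₂ : ∀ g : K[X], g ≠ 0 → g.natDegree < f.natDegree →
      ∀ x, (g.map π₂).eval x = 0 → ∃ k, π₂ k = x)
    {α : R₁} (hα : (f.map π₁).eval α = 0) : ∃ k, π₁ k = α := by
  by_contra! hne
  have hdeg : f.natDegree ≠ 0 := by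
    intro h
    rw [eq_C_of_natDegree_eq_zero h] at hα hf
    simp at hα
    simp [hα] at hf
  have hf' : derivative f ≠ 0 := fun h => hdeg (derivative_eq_zero.1 h)
  have hdeg' : (derivative f).natDegree < f.natDegree := natDegree_derivative_lt hdeg
  obtain ⟨k, hk⟩ := exists_abs_lt_of_root hπ₁ hf hα
  rw [abs_lt] at hk
  obtain ⟨a₀, b₀, -, -, ha₀, hb₀, hZ₀⟩ := exists_Ioo_avoiding hπ₁ hne
    (a₀ := -k) (b₀ := k) (by simpa using hk.1) hk.2 (derivative f).roots.toFinset
  have hD₁ := eval_map_ne_zero_of_roots_notMem hπ₁ hf' (ih₁ _ hf' hdeg') hZ₀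
  have hD₂ := eval_map_ne_zero_of_roots_notMem hπ₂ hf' (ih₂ _ hf' hdeg') hZ₀
  rw [← derivative_map] at hD₁ hD₂
  have hinj := h₂.injOn_eval hD₂
  have hroot : ∀ a b, a₀ ≤ a → b ≤ b₀ → π₁ a < α → α < π₁ b →
      ∃ β ∈ Set.Ioo (π₂ a) (π₂ b), (f.map π₂).eval β = 0 := by
    intro a b ha hb haα hαb
    refine h₂ _ _ _ (hπ₂ (hπ₁.lt_iff_lt.1 (haα.trans hαb))) ?_
    rw [eval_mul_eval_neg_iff hπ₂, ← eval_mul_eval_neg_iff hπ₁]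
    refine h₁.eval_mul_eval_neg (fun x hx => hD₁ x ?_) ⟨haα, hαb⟩ hα
    exact ⟨(hπ₁.monotone ha).trans_lt hx.1, hx.2.trans_le (hπ₁.monotone hb)⟩
  obtain ⟨β, hβ, hβ0⟩ := hroot a₀ b₀ le_rfl le_rfl ha₀ hb₀
  obtain ⟨k, hk1, -⟩ := hmax α β (by
    intro g
    rw [eval_map_mod π₁ g hα, eval_map_mod π₂ g hβ0]
    by_cases hr : g % f = 0
    · simp [hr]
    have hrdeg : (g % f).natDegree < f.natDegree := natDegree_mod_lt g hdeg
    obtain ⟨a, b, ha, hb, haα, hαb, hZ⟩ := exists_Ioo_avoiding hπ₁ hne ha₀ hb₀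
      (g % f).roots.toFinset
    obtain ⟨γ, hγ, hγ0⟩ := hroot a b ha hb haα hαb
    have hγβ : γ = β := by
      refine hinj ⟨?_, ?_⟩ ⟨hβ.1.le, hβ.2.le⟩ (hγ0.trans hβ0.symm)
      · exact (hπ₂.monotone ha).trans hγ.1.le
      · exact hγ.2.le.trans (hπ₂.monotone hb)
    subst hγβ
    obtain ⟨m, hm⟩ := exists_between (hπ₁.lt_iff_lt.1 (haα.trans hαb))
    rw [h₁.sign_eval_eq Set.ordConnected_Ioo
        (eval_map_ne_zero_of_roots_notMem hπ₁ hr (ih₁ _ hr hrdeg) hZ) ⟨haα, hαb⟩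
        (⟨hπ₁ hm.1, hπ₁ hm.2⟩ : π₁ m ∈ Set.Ioo (π₁ a) (π₁ b)),
      h₂.sign_eval_eq Set.ordConnected_Ioo
        (eval_map_ne_zero_of_roots_notMem hπ₂ hr (ih₂ _ hr hrdeg) hZ) hγ
        (⟨hπ₂ hm.1, hπ₂ hm.2⟩ : π₂ m ∈ Set.Ioo (π₂ a) (π₂ b)),
      eval_map_apply_eq, eval_map_apply_eq, sign_apply_of_strictMono hπ₁,
      sign_apply_of_strictMono hπ₂])
  exact hne k hk1

/-- A maximal common ordered subfield of two ordered fields with the intermediate value property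
is relatively algebraically closed in both. -/
theorem root_mem_range_of_maximal {π₁ : K →+* R₁} {π₂ : K →+* R₂}
    (h₁ : HasPolynomialIVT R₁) (h₂ : HasPolynomialIVT R₂)
    (hπ₁ : StrictMono π₁) (hπ₂ : StrictMono π₂)
    (hmax : ∀ α β, (∀ g : K[X], SignType.sign ((g.map π₁).eval α) =
      SignType.sign ((g.map π₂).eval β)) → ∃ k, π₁ k = α ∧ π₂ k = β) (f : K[X]) (hf : f ≠ 0) :
    (∀ x, (f.map π₁).eval x = 0 → ∃ k, π₁ k = x) ∧
      (∀ x, (f.map π₂).eval x = 0 → ∃ k, π₂ k = x) := by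
  induction hn : f.natDegree using Nat.strong_induction_on generalizing f with
  | _ n ih =>
    subst hn
    refine ⟨fun x => root_mem_range_of_lt h₁ h₂ hπ₁ hπ₂ hmax hf (fun g hg hlt => (ih _ hlt g hg rfl).1)
      (fun g hg hlt => (ih _ hlt g hg rfl).2), fun x => root_mem_range_of_lt h₂ h₁ hπ₂ hπ₁ ?_ hf
      (fun g hg hlt => (ih _ hlt g hg rfl).2) (fun g hg hlt => (ih _ hlt g hg rfl).1)⟩
    intro α β h
    obtain ⟨k, h1, h2⟩ := hmax β α (fun g => (h g).symm)
    exact ⟨k, h2, h1⟩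

theorem exists_sign_eq_of_maximal {π₁ : K →+* R₁} {π₂ : K →+* R₂}
    (h₁ : HasPolynomialIVT R₁) (h₂ : HasPolynomialIVT R₂)
    (hπ₁ : StrictMono π₁) (hπ₂ : StrictMono π₂)
    (hmax : ∀ α β, (∀ g : K[X], SignType.sign ((g.map π₁).eval α) =
      SignType.sign ((g.map π₂).eval β)) → ∃ k, π₁ k = α ∧ π₂ k = β)
    (t : R₁) (S : Finset K[X]) :
    ∃ s : R₂, ∀ f ∈ S, SignType.sign ((f.map π₁).eval t) = SignType.sign ((f.map π₂).eval s) := by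
  have hsign (f : K[X]) (m : K) :
      SignType.sign ((f.map π₁).eval (π₁ m)) = SignType.sign ((f.map π₂).eval (π₂ m)) := by
    rw [eval_map_apply_eq, eval_map_apply_eq, sign_apply_of_strictMono hπ₁,
      sign_apply_of_strictMono hπ₂]
  by_cases ht : ∃ k, π₁ k = t
  · obtain ⟨k, rfl⟩ := ht
    exact ⟨π₂ k, fun f _ => hsign f k⟩
  push Not at ht
  let Z : Finset K := S.biUnion fun f => f.roots.toFinset
  obtain ⟨m, hlo, hhi⟩ := Order.exists_between_finsets (Z.filter fun z => π₁ z < t)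
    (Z.filter fun z => t < π₁ z) (by
      intro x hx y hy
      exact hπ₁.lt_iff_lt.1 ((Finset.mem_filter.1 hx).2.trans (Finset.mem_filter.1 hy).2))
  refine ⟨π₂ m, fun f hf => ?_⟩
  rcases eq_or_ne f 0 with rfl | hf0
  · simp
  rw [← hsign]
  refine h₁.sign_eval_eq (s := Set.uIcc t (π₁ m)) Set.ordConnected_uIcc ?_ Set.left_mem_uIcc
    Set.right_mem_uIcc
  intro x hx h0
  obtain ⟨z, rfl⟩ := (root_mem_range_of_maximal h₁ h₂ hπ₁ hπ₂ hmax f hf0).1 x h0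
  rw [eval_map_apply_eq, map_eq_zero] at h0
  have hz : z ∈ Z := Finset.mem_biUnion.2 ⟨f, hf, by simp [hf0, h0]⟩
  rw [Set.mem_uIcc] at hx
  rcases lt_or_gt_of_ne (ht z) with h | h
  · have h3 := hπ₁ (hlo z (Finset.mem_filter.2 ⟨hz, h⟩))
    rcases hx with hx | hx
    · exact hx.1.not_gt h
    · exact hx.1.not_gt h3
  · have h3 := hπ₁ (hhi z (Finset.mem_filter.2 ⟨hz, h⟩))
    rcases hx with hx | hx
    · exact hx.2.not_gt h3
    · exact hx.2.not_gt h

end RelativeClosure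

section Transfer

variable {R₁ R₂ : Type*} [Field R₁] [LinearOrder R₁] [Field R₂] [LinearOrder R₂]

/-- A subring of `R₁ × R₂` is sign compatible if the two coordinates of each of its elements have
the same sign; it is then the graph of an isomorphism between ordered subrings. -/
def SignCompatible (G : Subring (R₁ × R₂)) : Prop :=
  ∀ z ∈ G, SignType.sign z.1 = SignType.sign z.2

theorem SignCompatible.exists_maximal {G : Subring (R₁ × R₂)} (hG : SignCompatible G) :
    ∃ M, G ≤ M ∧ Maximal SignCompatible M := by
  refine zorn_le_nonempty₀ {G : Subring (R₁ × R₂) | SignCompatible G} ?_ G hG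
  intro c hc hchain y hy
  refine ⟨sSup c, ?_, fun z hz => le_sSup hz⟩
  intro z hz
  obtain ⟨s, hs, hzs⟩ := (Subring.mem_sSup_of_directedOn ⟨y, hy⟩ hchain.directedOn).1 hz
  exact hc hs z hzs

theorem mem_of_maximal_signCompatible {G : Subring (R₁ × R₂)} (hG : Maximal SignCompatible G)
    {α : R₁} {β : R₂}
    (h : ∀ g : G[X], SignType.sign ((g.map ((RingHom.fst R₁ R₂).comp G.subtype)).eval α) =
      SignType.sign ((g.map ((RingHom.snd R₁ R₂).comp G.subtype)).eval β)) : (α, β) ∈ G := by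
  let ψ : G[X] →+* R₁ × R₂ :=
    (eval₂RingHom ((RingHom.fst R₁ R₂).comp G.subtype) α).prod
      (eval₂RingHom ((RingHom.snd R₁ R₂).comp G.subtype) β)
  have hle : G ≤ ψ.range := fun z hz => ⟨C ⟨z, hz⟩, by simp [ψ]⟩
  refine hG.le_of_ge ?_ hle ⟨X, by simp [ψ]⟩
  rintro _ ⟨g, rfl⟩
  simpa [ψ, eval_map] using h g

variable [IsStrictOrderedRing R₁] [IsStrictOrderedRing R₂]

theorem inv_mem_of_maximal_signCompatible {G : Subring (R₁ × R₂)}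
    (hG : Maximal SignCompatible G) {z : R₁ × R₂} (hz : z ∈ G) : (z.1⁻¹, z.2⁻¹) ∈ G := by
  by_cases h0 : z.1 = 0
  · have h2 : z.2 = 0 := by
      have := hG.prop z hz
      rwa [h0, sign_zero, eq_comm, sign_eq_zero_iff] at this
    rw [h0, h2, _root_.inv_zero, _root_.inv_zero]
    exact G.zero_mem
  have h2 : z.2 ≠ 0 := fun h => h0 (by
    have := hG.prop z hz
    rwa [h, sign_zero, sign_eq_zero_iff] at this)
  let G' : Subring (R₁ × R₂) :=
    { carrier := {w | ∃ b ∈ G, b.1 ≠ 0 ∧ b * w ∈ G}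
      zero_mem' := ⟨1, G.one_mem, by simp, by simp [G.zero_mem]⟩
      one_mem' := ⟨1, G.one_mem, by simp, by simp [G.one_mem]⟩
      add_mem' := by
        rintro u v ⟨b, hb, hb0, hbu⟩ ⟨c, hc, hc0, hcv⟩
        refine ⟨b * c, G.mul_mem hb hc, mul_ne_zero hb0 hc0, ?_⟩
        have := G.add_mem (G.mul_mem hc hbu) (G.mul_mem hb hcv)
        convert this using 1
        ring
      mul_mem' := by
        rintro u v ⟨b, hb, hb0, hbu⟩ ⟨c, hc, hc0, hcv⟩
        refine ⟨b * c, G.mul_mem hb hc, mul_ne_zero hb0 hc0, ?_⟩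
        have := G.mul_mem hbu hcv
        convert this using 1
        ring
      neg_mem' := by
        rintro u ⟨b, hb, hb0, hbu⟩
        exact ⟨b, hb, hb0, by simpa using G.neg_mem hbu⟩ }
  have hle : G ≤ G' := fun w hw => ⟨1, G.one_mem, by simp, by simpa using hw⟩
  refine hG.le_of_ge (y := G') ?_ hle ⟨z, hz, h0, ?_⟩
  · rintro w ⟨b, hb, hb0, hbw⟩
    have h1 := hG.prop _ hbw
    rw [Prod.fst_mul, Prod.snd_mul, sign_mul, sign_mul, ← hG.prop b hb] at h1
    exact mul_left_cancel₀ (by simpa [sign_eq_zero_iff] using hb0) h1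
  · have : z * (z.1⁻¹, z.2⁻¹) = 1 := by ext <;> simp [h0, h2]
    rw [this]
    exact G.one_mem

theorem exists_sign_eq_of_isField (h₁ : HasPolynomialIVT R₁) (h₂ : HasPolynomialIVT R₂)
    {K : Type*} [CommRing K] (hK : IsField K) (π₁ : K →+* R₁) (π₂ : K →+* R₂)
    (hπ : ∀ k, SignType.sign (π₁ k) = SignType.sign (π₂ k))
    (hmax : ∀ α β, (∀ g : K[X], SignType.sign ((g.map π₁).eval α) =
      SignType.sign ((g.map π₂).eval β)) → ∃ k, π₁ k = α ∧ π₂ k = β) (t : R₁) (S : Finset K[X]) :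
    ∃ s : R₂, ∀ f ∈ S, SignType.sign ((f.map π₁).eval t) = SignType.sign ((f.map π₂).eval s) := by
  let _ : Field K := hK.toField
  have hinj : Function.Injective π₁ := π₁.injective
  let _ : LinearOrder K := LinearOrder.lift' π₁ hinj
  have hmono₁ : StrictMono π₁ := Monotone.strictMono_of_injective (fun _ _ h => h) hinj
  have : IsStrictOrderedRing K :=
    Function.Injective.isStrictOrderedRing π₁ (map_zero _) (map_one _) (map_add _) (map_mul _)
      hmono₁.le_iff_le hmono₁.lt_iff_lt
  have hmono₂ : StrictMono π₂ := by
    intro x y hxy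
    have h1 : 0 < π₁ (y - x) := by simpa using hmono₁ hxy
    have h3 := hπ (y - x)
    rw [sign_pos h1, eq_comm, sign_eq_one_iff] at h3
    simpa using h3
  exact exists_sign_eq_of_maximal h₁ h₂ hmono₁ hmono₂ hmax t S

theorem isField_of_maximal_signCompatible {G : Subring (R₁ × R₂)}
    (hG : Maximal SignCompatible G) : IsField G where
  exists_pair_ne := ⟨0, 1, zero_ne_one⟩
  mul_comm := mul_comm
  mul_inv_cancel := by
    intro z hz
    refine ⟨⟨_, inv_mem_of_maximal_signCompatible hG z.2⟩, ?_⟩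
    have hsign := hG.prop _ z.2
    have h1 : z.1.1 ≠ 0 := by
      intro h
      rw [h, sign_zero, eq_comm, sign_eq_zero_iff] at hsign
      exact hz (Subtype.ext (Prod.ext h hsign))
    have h2 : z.1.2 ≠ 0 := by
      intro h
      rw [h, sign_zero, sign_eq_zero_iff] at hsign
      exact h1 hsign
    ext <;> simp [h1, h2]

/-- Two ordered fields with the intermediate value property which induce the same signs on a ring
realize the same sign conditions for polynomials in one variable over that ring. -/
theorem exists_sign_eval_map_eq (h₁ : HasPolynomialIVT R₁) (h₂ : HasPolynomialIVT R₂)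
    {A : Type*} [CommRing A] (φ₁ : A →+* R₁) (φ₂ : A →+* R₂)
    (hφ : ∀ a, SignType.sign (φ₁ a) = SignType.sign (φ₂ a)) (t : R₁) (S : Finset A[X]) :
    ∃ s : R₂, ∀ f ∈ S,
      SignType.sign ((f.map φ₁).eval t) = SignType.sign ((f.map φ₂).eval s) := by
  classical
  have hrange : SignCompatible (φ₁.prod φ₂).range := by
    rintro _ ⟨a, rfl⟩
    exact hφ a
  obtain ⟨G, hle, hG⟩ := hrange.exists_maximal
  let ψ : A →+* G := (φ₁.prod φ₂).codRestrict G fun a => hle ⟨a, rfl⟩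
  obtain ⟨s, hs⟩ := exists_sign_eq_of_isField h₁ h₂ (isField_of_maximal_signCompatible hG)
    ((RingHom.fst R₁ R₂).comp G.subtype) ((RingHom.snd R₁ R₂).comp G.subtype)
    (fun z => hG.prop z z.2)
    (fun α β h => ⟨⟨(α, β), mem_of_maximal_signCompatible hG h⟩, rfl, rfl⟩) t (S.image (map ψ))
  refine ⟨s, fun f hf => ?_⟩
  have := hs _ (Finset.mem_image_of_mem _ hf)
  rw [Polynomial.map_map, Polynomial.map_map] at this
  exact this

end Transfer

section RealPoints

theorem hasPolynomialIVT_real : HasPolynomialIVT ℝ := by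
  intro f a b hab h
  have hc : ContinuousOn (fun x => f.eval x) (Set.Icc a b) := f.continuous.continuousOn
  rcases mul_neg_iff.1 h with ⟨h1, h2⟩ | ⟨h1, h2⟩
  · obtain ⟨c, hc, h0⟩ := intermediate_value_Ioo' hab.le hc ⟨h2, h1⟩
    exact ⟨c, hc, h0⟩
  · obtain ⟨c, hc, h0⟩ := intermediate_value_Ioo hab.le hc ⟨h1, h2⟩
    exact ⟨c, hc, h0⟩

theorem strictMono_of_real_ringHom {R : Type*} [Field R] [LinearOrder R] [IsStrictOrderedRing R]
    (ι : ℝ →+* R) : StrictMono ι := by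
  intro x y hxy
  have h : y = x + √(y - x) ^ 2 := by
    rw [Real.sq_sqrt (sub_nonneg.2 hxy.le)]
    ring
  have h0 : ι √(y - x) ≠ 0 := by
    rw [_root_.map_ne_zero]
    exact (Real.sqrt_pos.2 (sub_pos.2 hxy)).ne'
  rw [h, map_add, map_pow]
  exact lt_add_of_pos_right _ (by positivity)

variable {I : Type*} {U : Ultrafilter I}

theorem Filter.Germ.sign_coe_eq {u : I → ℝ} {ε : SignType}
    (h : ∀ᶠ i in (U : Filter I), SignType.sign (u i) = ε) :
    SignType.sign (u : Filter.Germ (U : Filter I) ℝ) = ε := by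
  match ε with
  | 1 => exact sign_pos (Filter.Germ.coe_lt.2 (h.mono fun i hi => sign_eq_one_iff.1 hi))
  | -1 => exact sign_neg (Filter.Germ.coe_lt.2 (h.mono fun i hi => sign_eq_neg_one_iff.1 hi))
  | 0 =>
    exact sign_eq_zero_iff.2 (Filter.Germ.coe_eq.2 (h.mono fun i hi => sign_eq_zero_iff.1 hi))

theorem Filter.Germ.eventually_sign_eq {u : I → ℝ} {ε : SignType}
    (h : SignType.sign (u : Filter.Germ (U : Filter I) ℝ) = ε) :
    ∀ᶠ i in (U : Filter I), SignType.sign (u i) = ε := by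
  match ε with
  | 1 => exact (Filter.Germ.coe_lt.1 (sign_eq_one_iff.1 h)).mono fun i hi => sign_pos hi
  | -1 => exact (Filter.Germ.coe_lt.1 (sign_eq_neg_one_iff.1 h)).mono fun i hi => sign_neg hi
  | 0 =>
    exact (Filter.Germ.coe_eq.1 (sign_eq_zero_iff.1 h)).mono fun i hi => sign_eq_zero_iff.2 hi

theorem eval_germ_eq {A : Type*} [CommRing A] (φ : ∀ _ : I, A →+* ℝ) (σ : I → ℝ) (f : A[X]) :
    (f.map ((Filter.Germ.coeRingHom (U : Filter I)).comp (RingHom.pi φ))).eval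
        (σ : Filter.Germ (U : Filter I) ℝ) =
      ((fun i => (f.map (φ i)).eval (σ i) : I → ℝ) : Filter.Germ (U : Filter I) ℝ) := by
  rw [eval_map]
  have h := hom_eval₂ f (RingHom.pi φ) (Filter.Germ.coeRingHom (R := ℝ) (U : Filter I)) σ
  refine h.symm.trans ?_
  change ((eval₂ (RingHom.pi φ) σ f : I → ℝ) : Filter.Germ (U : Filter I) ℝ) = _
  congr 1
  funext i
  rw [eval_map]
  exact hom_eval₂ f (RingHom.pi φ) (Pi.evalRingHom (fun _ : I => ℝ) i) σ

theorem exists_map_pi_eq (f : (Filter.Germ (U : Filter I) ℝ)[X]) :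
    ∃ F : (I → ℝ)[X], F.map (Filter.Germ.coeRingHom (U : Filter I)) = f := by
  exact map_surjective _ Quot.mk_surjective f

theorem hasPolynomialIVT_germ : HasPolynomialIVT (Filter.Germ (U : Filter I) ℝ) := by
  intro f a b hab h
  obtain ⟨F, rfl⟩ := exists_map_pi_eq f
  have heval (σ : I → ℝ) := eval_germ_eq (U := U) (fun i => Pi.evalRingHom (fun _ : I => ℝ) i) σ F
  have hid : (Filter.Germ.coeRingHom (U : Filter I)).comp
      (RingHom.pi fun i => Pi.evalRingHom (fun _ : I => ℝ) i) = Filter.Germ.coeRingHom _ := rfl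
  simp only [hid] at heval
  induction a using Filter.Germ.inductionOn with | _ a
  induction b using Filter.Germ.inductionOn with | _ b
  rw [heval, heval, ← Filter.Germ.coe_mul, ← Filter.Germ.coe_zero, Filter.Germ.coe_lt] at h
  rw [Filter.Germ.coe_lt] at hab
  have key : ∀ᶠ i in (U : Filter I), ∃ c, c ∈ Set.Ioo (a i) (b i) ∧
      (F.map (Pi.evalRingHom (fun _ : I => ℝ) i)).eval c = 0 := by
    filter_upwards [hab, h] with i hi hi'
    exact hasPolynomialIVT_real _ _ _ hi hi'
  obtain ⟨c, hc⟩ := Filter.Eventually.choice key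
  refine ⟨c, ⟨Filter.Germ.coe_lt.2 (hc.mono fun i hi => hi.1.1),
    Filter.Germ.coe_lt.2 (hc.mono fun i hi => hi.1.2)⟩, ?_⟩
  rw [heval]
  exact Filter.Germ.coe_eq.2 (hc.mono fun i hi => hi.2)

theorem eval₂Hom_eq_eval_map_finSuccEquiv {R S : Type*} [CommRing R] [CommRing S] (ι : R →+* S)
    {n : ℕ} (t : Fin (n + 1) → S) (f : MvPolynomial (Fin (n + 1)) R) :
    MvPolynomial.eval₂Hom ι t f = ((MvPolynomial.finSuccEquiv R n f).map
      (MvPolynomial.eval₂Hom ι (Fin.tail t))).eval (t 0) := by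
  have : MvPolynomial.eval₂Hom ι t =
      ((evalRingHom (t 0)).comp (mapRingHom (MvPolynomial.eval₂Hom ι (Fin.tail t)))).comp
        (MvPolynomial.finSuccEquiv R n : MvPolynomial (Fin (n + 1)) R →+* _) := by
    refine MvPolynomial.ringHom_ext (fun r => ?_) (fun i => ?_)
    · simp [MvPolynomial.finSuccEquiv_apply]
    · refine Fin.cases ?_ (fun i => ?_) i
      · simp [MvPolynomial.finSuccEquiv_X_zero]
      · simp [MvPolynomial.finSuccEquiv_X_succ, Fin.tail]
  exact congrArg (fun φ => φ f) this

/-- **Artin–Lang.** Every finite set of sign conditions on real polynomials which is realized in an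
ordered extension field of `ℝ` with the intermediate value property is realized in `ℝ`. -/
theorem exists_real_point_sign_eq {R : Type*} [Field R] [LinearOrder R] [IsStrictOrderedRing R]
    (hR : HasPolynomialIVT R) (ι : ℝ →+* R) (n : ℕ) (t : Fin n → R)
    (S : Finset (MvPolynomial (Fin n) ℝ)) :
    ∃ x : Fin n → ℝ, ∀ f ∈ S,
      SignType.sign (MvPolynomial.eval x f) = SignType.sign (MvPolynomial.eval₂Hom ι t f) := by
  classical
  induction n with
  | zero =>
    refine ⟨Fin.elim0, fun f _ => ?_⟩
    rw [MvPolynomial.eq_C_of_isEmpty f]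
    simp only [MvPolynomial.eval_C, MvPolynomial.eval₂Hom_C]
    exact (sign_apply_of_strictMono (strictMono_of_real_ringHom ι) _).symm
  | succ n ih =>
    choose x hx using ih (Fin.tail t)
    let U : Ultrafilter (Finset (MvPolynomial (Fin n) ℝ)) := Ultrafilter.of Filter.atTop
    let φ : MvPolynomial (Fin n) ℝ →+* Filter.Germ (U : Filter (Finset (MvPolynomial (Fin n) ℝ))) ℝ :=
      (Filter.Germ.coeRingHom (U : Filter (Finset (MvPolynomial (Fin n) ℝ)))).comp
        (RingHom.pi fun T => MvPolynomial.eval (x T))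
    have hφ (f) : SignType.sign (MvPolynomial.eval₂Hom ι (Fin.tail t) f) =
        SignType.sign (φ f) := by
      refine (Filter.Germ.sign_coe_eq ?_).symm
      refine Filter.Eventually.filter_mono (Ultrafilter.of_le _) ?_
      filter_upwards [Filter.eventually_ge_atTop {f}] with T hT
      exact hx T f (hT (Finset.mem_singleton_self f))
    obtain ⟨s, hs⟩ := exists_sign_eval_map_eq hR hasPolynomialIVT_germ _ φ hφ (t 0)
      (S.image (MvPolynomial.finSuccEquiv ℝ n))
    induction s using Filter.Germ.inductionOn with | _ σ
    have key : ∀ᶠ T in (U : Filter (Finset (MvPolynomial (Fin n) ℝ))), ∀ f ∈ S,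
        SignType.sign (((MvPolynomial.finSuccEquiv ℝ n f).map (MvPolynomial.eval (x T))).eval (σ T))
          = SignType.sign (MvPolynomial.eval₂Hom ι t f) := by
      rw [Filter.eventually_all_finset]
      intro f hf
      apply Filter.Germ.eventually_sign_eq
      rw [← eval_germ_eq, eval₂Hom_eq_eval_map_finSuccEquiv]
      exact (hs _ (Finset.mem_image_of_mem _ hf)).symm
    obtain ⟨T, hT⟩ := key.exists
    refine ⟨Fin.cons (σ T) (x T), fun f hf => ?_⟩
    rw [MvPolynomial.eval_eq_eval_mv_eval']
    exact hT f hf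

end RealPoints

section SquareCone

variable {Ω : Type*} [Field Ω]

/-- A subsemiring `P` of a field is a square cone if `P ∩ -P = 0` and it contains the squares of
the differences of its elements; it then orders, possibly partially, the subring `P - P`. -/
def IsSquareCone (P : Subsemiring Ω) : Prop :=
  (∀ x ∈ P, -x ∈ P → x = 0) ∧ ∀ x ∈ P, ∀ y ∈ P, (x - y) ^ 2 ∈ P

theorem IsSquareCone.exists_maximal {P : Subsemiring Ω} (hP : IsSquareCone P) :
    ∃ M, P ≤ M ∧ Maximal IsSquareCone M := by
  refine zorn_le_nonempty₀ {P : Subsemiring Ω | IsSquareCone P} ?_ P hP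
  intro c hc hchain P₀ hP₀
  have mem_sSup {x : Ω} : x ∈ sSup c ↔ ∃ s ∈ c, x ∈ s :=
    Subsemiring.mem_sSup_of_directedOn ⟨P₀, hP₀⟩ hchain.directedOn
  have common {x y : Ω} (hx : x ∈ sSup c) (hy : y ∈ sSup c) : ∃ s ∈ c, x ∈ s ∧ y ∈ s := by
    obtain ⟨s, hs, hxs⟩ := mem_sSup.1 hx
    obtain ⟨t, ht, hyt⟩ := mem_sSup.1 hy
    obtain ⟨u, hu, hsu, htu⟩ := hchain.directedOn s hs t ht
    exact ⟨u, hu, hsu hxs, htu hyt⟩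
  refine ⟨sSup c, ⟨fun x hx hnx => ?_, fun x hx y hy => ?_⟩, fun s hs => le_sSup hs⟩
  · obtain ⟨s, hs, hxs, hnxs⟩ := common hx hnx
    exact (hc hs).1 x hxs hnxs
  · obtain ⟨s, hs, hxs, hys⟩ := common hx hy
    exact mem_sSup.2 ⟨s, hs, (hc hs).2 x hxs y hys⟩

variable {P : Subsemiring Ω}

theorem mem_of_mul_mem_of_maximal (hP : Maximal IsSquareCone P) {b z : Ω} (hb : b ∈ P)
    (hb0 : b ≠ 0) (hz : b * z ∈ P) : z ∈ P := by
  let Q : Subsemiring Ω :=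
    { carrier := {z | ∃ b ∈ P, b ≠ 0 ∧ b * z ∈ P}
      mul_mem' := by
        rintro x y ⟨b, hb, hb0, hx⟩ ⟨c, hc, hc0, hy⟩
        exact ⟨b * c, mul_mem hb hc, mul_ne_zero hb0 hc0,
          by simpa only [mul_mul_mul_comm] using mul_mem hx hy⟩
      one_mem' := ⟨1, one_mem P, one_ne_zero, by simp⟩
      add_mem' := by
        rintro x y ⟨b, hb, hb0, hx⟩ ⟨c, hc, hc0, hy⟩
        refine ⟨b * c, mul_mem hb hc, mul_ne_zero hb0 hc0, ?_⟩
        convert add_mem (mul_mem hc hx) (mul_mem hb hy) using 1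
        ring
      zero_mem' := ⟨1, one_mem P, one_ne_zero, by simp⟩ }
  have hPQ : P ≤ Q := fun x hx => ⟨1, one_mem P, one_ne_zero, by simpa using hx⟩
  refine hP.le_of_ge ⟨?_, ?_⟩ hPQ ⟨b, hb, hb0, hz⟩
  · rintro x ⟨b, hb, hb0, hx⟩ ⟨c, hc, hc0, hy⟩
    have : c * (b * x) = 0 := by
      refine hP.prop.1 _ (mul_mem hc hx) ?_
      convert mul_mem hb hy using 1
      ring
    simpa [hb0, hc0] using this
  · rintro x ⟨b, hb, hb0, hx⟩ y ⟨c, hc, hc0, hy⟩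
    refine ⟨(b * c) ^ 2, pow_mem (mul_mem hb hc) 2, pow_ne_zero 2 (mul_ne_zero hb0 hc0), ?_⟩
    convert hP.prop.2 _ (mul_mem hc hx) _ (mul_mem hb hy) using 1
    ring

theorem inv_mem_of_maximal (hP : Maximal IsSquareCone P) {x : Ω} (hx : x ∈ P) : x⁻¹ ∈ P := by
  rcases eq_or_ne x 0 with rfl | h
  · simp
  · exact mem_of_mul_mem_of_maximal hP hx h (by simp [h])

theorem sub_mem_or_of_maximal (hP : Maximal IsSquareCone P) {u v : Ω} (hu : u ∈ P) (hv : v ∈ P) :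
    u - v ∈ P ∨ -(u - v) ∈ P := by
  refine or_iff_not_imp_left.2 fun hx => ?_
  let Q : Subsemiring Ω :=
    { carrier := {z | ∃ a ∈ P, ∃ b ∈ P, z = a - b * (u - v)}
      mul_mem' := by
        rintro _ _ ⟨a, ha, b, hb, rfl⟩ ⟨c, hc, d, hd, rfl⟩
        exact ⟨a * c + b * d * (u - v) ^ 2,
          add_mem (mul_mem ha hc) (mul_mem (mul_mem hb hd) (hP.prop.2 _ hu _ hv)),
          a * d + b * c, add_mem (mul_mem ha hd) (mul_mem hb hc), by ring⟩
      one_mem' := ⟨1, one_mem P, 0, zero_mem P, by simp⟩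
      add_mem' := by
        rintro _ _ ⟨a, ha, b, hb, rfl⟩ ⟨c, hc, d, hd, rfl⟩
        exact ⟨a + c, add_mem ha hc, b + d, add_mem hb hd, by ring⟩
      zero_mem' := ⟨0, zero_mem P, 0, zero_mem P, by simp⟩ }
  have hPQ : P ≤ Q := fun x hx => ⟨x, hx, 0, zero_mem P, by simp⟩
  refine hP.le_of_ge ⟨?_, ?_⟩ hPQ ⟨0, zero_mem P, 1, one_mem P, by simp⟩
  · rintro _ ⟨a, ha, b, hb, rfl⟩ ⟨c, hc, d, hd, h⟩
    have hbd : b + d = 0 := by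
      by_contra hne
      refine hx (mem_of_mul_mem_of_maximal hP (add_mem hb hd) hne ?_)
      convert add_mem ha hc using 1
      linear_combination h
    have hb0 : b = 0 := hP.prop.1 b hb (by rwa [neg_eq_of_add_eq_zero_right hbd])
    have hd0 : d = 0 := by simpa [hb0] using hbd
    have hac : -a = c := by simpa [hb0, hd0] using h
    have ha0 : a = 0 := hP.prop.1 a ha (hac ▸ hc)
    simp [ha0, hb0]
  · rintro _ ⟨a, ha, b, hb, rfl⟩ _ ⟨c, hc, d, hd, rfl⟩
    refine hPQ ?_
    convert hP.prop.2 _ (add_mem (add_mem ha (mul_mem hb hv)) (mul_mem hd hu)) _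
      (add_mem (add_mem hc (mul_mem hd hv)) (mul_mem hb hu)) using 1
    ring

theorem exists_ordered_subfield_of_maximal (hP : Maximal IsSquareCone P) :
    ∃ (E : Subfield Ω) (_ : LinearOrder E) (_ : IsStrictOrderedRing E),
      (∀ x ∈ P, x ∈ E) ∧ ∀ x : E, 0 ≤ x ↔ (x : Ω) ∈ P := by
  classical
  have diff {x : Ω} (hx : x ∈ P ∨ -x ∈ P) : ∃ u ∈ P, ∃ v ∈ P, x = u - v := by
    rcases hx with hx | hx
    · exact ⟨x, hx, 0, zero_mem P, by simp⟩
    · exact ⟨0, zero_mem P, -x, hx, by simp⟩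
  let E : Subfield Ω :=
    { carrier := {x | x ∈ P ∨ -x ∈ P}
      mul_mem' := by
        intro x y hx hy
        obtain ⟨a, ha, b, hb, rfl⟩ := diff hx
        obtain ⟨c, hc, d, hd, rfl⟩ := diff hy
        have := sub_mem_or_of_maximal hP (add_mem (mul_mem ha hc) (mul_mem hb hd))
          (add_mem (mul_mem ha hd) (mul_mem hb hc))
        rwa [show a * c + b * d - (a * d + b * c) = (a - b) * (c - d) by ring] at this
      one_mem' := Or.inl (one_mem P)
      add_mem' := by
        intro x y hx hy
        obtain ⟨a, ha, b, hb, rfl⟩ := diff hx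
        obtain ⟨c, hc, d, hd, rfl⟩ := diff hy
        have := sub_mem_or_of_maximal hP (add_mem ha hc) (add_mem hb hd)
        rwa [add_sub_add_comm] at this
      zero_mem' := Or.inl (zero_mem P)
      neg_mem' := by
        intro x hx
        simpa [or_comm] using hx
      inv_mem' := by
        intro x hx
        refine hx.imp (inv_mem_of_maximal hP) fun hx => ?_
        simpa using inv_mem_of_maximal hP hx }
  let cone : RingCone E :=
    { P.comap (E.subtype : E →+* Ω) with
      eq_zero_of_mem_of_neg_mem' := fun {x} hx hnx => Subtype.ext (hP.prop.1 x hx hnx) }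
  have : HasMemOrNegMem cone := ⟨fun x => x.2⟩
  let _ : LinearOrder E := LinearOrder.mkOfAddGroupCone cone
  have : IsOrderedRing E := IsOrderedRing.mkOfCone cone
  refine ⟨E, inferInstance, IsOrderedRing.toIsStrictOrderedRing E, fun x hx => Or.inl hx,
    fun x => ?_⟩
  change x - 0 ∈ cone ↔ _
  rw [sub_zero]
  rfl

end SquareCone

section RealClosedExtension

/-- The semiring of sums of squares of polynomials with nonnegative weights. -/
noncomputable def weightedSumSq (K : Type*) [Field K] [LinearOrder K] [IsStrictOrderedRing K] :
    Subsemiring K[X] :=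
  Submonoid.subsemiringClosure
    { carrier := {q | ∃ (c : K) (g : K[X]), 0 ≤ c ∧ q = C c * g ^ 2}
      mul_mem' := by
        rintro _ _ ⟨c, g, hc, rfl⟩ ⟨d, h, hd, rfl⟩
        exact ⟨c * d, g * h, mul_nonneg hc hd, by rw [C_mul]; ring⟩
      one_mem' := ⟨1, 1, zero_le_one, by simp⟩ }

variable {K : Type*} [Field K] [LinearOrder K] [IsStrictOrderedRing K]

theorem C_mul_sq_mem_weightedSumSq {c : K} (hc : 0 ≤ c) (g : K[X]) :
    C c * g ^ 2 ∈ weightedSumSq K :=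
  AddSubmonoid.subset_closure ⟨c, g, hc, rfl⟩

theorem sq_mem_weightedSumSq (g : K[X]) : g ^ 2 ∈ weightedSumSq K := by
  simpa using C_mul_sq_mem_weightedSumSq zero_le_one g

theorem exists_nonneg_reduced_of_mem_weightedSumSq {f q : K[X]} (hf : 0 < f.natDegree)
    (hq : q ∈ weightedSumSq K) :
    ∃ r : K[X], f ∣ q - r ∧ r.natDegree ≤ 2 * (f.natDegree - 1) ∧ ∀ x, 0 ≤ r.eval x := by
  refine AddSubmonoid.closure_induction (fun q hq => ?_) ?_ (fun p q _ _ hp hq => ?_) hq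
  · obtain ⟨c, g, hc, rfl⟩ := hq
    refine ⟨C c * (g % f) ^ 2, ?_, ?_, fun x => ?_⟩
    · rw [← mul_sub, sq_sub_sq]
      have : f ∣ g - g % f := ⟨g / f, sub_eq_of_eq_add (EuclideanDomain.div_add_mod g f).symm⟩
      exact (this.mul_left _).mul_left _
    · have h1 : (g % f).natDegree < f.natDegree := natDegree_mod_lt g hf.ne'
      refine (natDegree_C_mul_le _ _).trans (natDegree_pow_le.trans ?_)
      omega
    · simp only [eval_mul, eval_C, eval_pow]
      positivity
  · exact ⟨0, by simp, by simp, by simp⟩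
  · obtain ⟨r, h1, h2, h3⟩ := hp
    obtain ⟨s, h4, h5, h6⟩ := hq
    refine ⟨r + s, ?_, (natDegree_add_le _ _).trans (max_le h2 h5), fun x => ?_⟩
    · rw [add_sub_add_comm]
      exact dvd_add h1 h4
    · rw [eval_add]
      exact add_nonneg (h3 x) (h6 x)

theorem eval_mul_eval_neg_or_of_mul {g h : K[X]} {a b : K}
    (hgh : (g * h).eval a * (g * h).eval b < 0) :
    g.eval a * g.eval b < 0 ∨ h.eval a * h.eval b < 0 := by
  by_contra! hc
  have := mul_nonneg hc.1 hc.2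
  rw [eval_mul, eval_mul] at hgh
  linarith [mul_mul_mul_comm (g.eval a) (h.eval a) (g.eval b) (h.eval b)]

theorem natDegree_pos_of_eval_mul_eval_neg {f : K[X]} {a b : K}
    (hf : f.eval a * f.eval b < 0) : 0 < f.natDegree := by
  by_contra! h0
  rw [eq_C_of_natDegree_le_zero h0, eval_C, eval_C] at hf
  exact hf.not_ge (mul_self_nonneg _)

/-- If `f` changes sign and its proper divisors have the intermediate value property, then
`-1` is not congruent to a weighted sum of squares modulo `f`. -/
theorem not_dvd_one_add_of_mem_weightedSumSq {f q : K[X]} {a b : K}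
    (hf : f.eval a * f.eval b < 0)
    (ih : ∀ h : K[X], h.natDegree < f.natDegree → h.eval a * h.eval b < 0 → ∃ c, h.eval c = 0)
    (hq : q ∈ weightedSumSq K) : ¬ f ∣ 1 + q := by
  intro hdvd
  have hd := natDegree_pos_of_eval_mul_eval_neg hf
  obtain ⟨r, hr, hrd, hr0⟩ := exists_nonneg_reduced_of_mem_weightedSumSq hd hq
  have hpos (x : K) : 0 < (1 + r).eval x := by
    rw [eval_add, eval_one]
    linarith [hr0 x]
  have hne : 1 + r ≠ 0 := fun h => by simpa [h] using hpos 0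
  obtain ⟨h, hh⟩ : f ∣ 1 + r := by
    have := dvd_sub hdvd hr
    rwa [show 1 + q - (q - r) = 1 + r by ring] at this
  have hf0 : f ≠ 0 := fun h0 => by simp [h0] at hd
  have hh0 : h ≠ 0 := fun h0 => hne (by rw [hh, h0, mul_zero])
  have hdeg : f.natDegree + h.natDegree ≤ 2 * (f.natDegree - 1) := by
    rw [← natDegree_mul hf0 hh0, ← hh]
    exact (natDegree_add_le _ _).trans (max_le (by simp) hrd)
  have hchange : h.eval a * h.eval b < 0 := by
    have h1 := mul_pos (hpos a) (hpos b)
    rw [hh, eval_mul, eval_mul, mul_mul_mul_comm] at h1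
    exact neg_of_mul_pos_right h1 hf.le
  obtain ⟨c, hc⟩ := ih h (by omega) hchange
  have := hpos c
  rw [hh, eval_mul, hc, mul_zero] at this
  exact this.false

theorem Irreducible.dvd_of_aeval_eq_zero {F Ω : Type*} [Field F] [Field Ω] [Algebra F Ω]
    {f g : F[X]} (hf : Irreducible f) {α : Ω} (hfα : aeval α f = 0) (hgα : aeval α g = 0) :
    f ∣ g := by
  by_contra h
  obtain ⟨u, v, huv⟩ := (hf.coprime_iff_not_dvd).2 h
  simpa [hfα, hgα] using congrArg (aeval α) huv

variable {Ω : Type*} [Field Ω] {P : Subsemiring Ω}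

theorem exists_root_of_irreducible_of_maximal (hP : Maximal IsSquareCone P) {E : Subfield Ω}
    [LinearOrder E] [IsStrictOrderedRing E] (hPE : ∀ x ∈ P, x ∈ E)
    (hE : ∀ x : E, 0 ≤ x ↔ (x : Ω) ∈ P) {f : E[X]} (hirr : Irreducible f) {a b : E}
    (hf : f.eval a * f.eval b < 0)
    (ih : ∀ h : E[X], h.natDegree < f.natDegree → h.eval a * h.eval b < 0 → ∃ c, h.eval c = 0)
    {α : Ω} (hα : aeval α f = 0) : ∃ c, f.eval c = 0 := by
  let Q : Subsemiring Ω := (weightedSumSq E).map (aeval α : E[X] →ₐ[E] Ω)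
  have hPQ : P ≤ Q := fun x hx =>
    ⟨C ⟨x, hPE x hx⟩, by simpa using C_mul_sq_mem_weightedSumSq ((hE ⟨x, hPE x hx⟩).2 hx) 1,
      aeval_C α _⟩
  have hQ : IsSquareCone Q := by
    constructor
    · rintro _ ⟨q, hq, rfl⟩ ⟨r, hr, hqr⟩
      by_contra hne
      have hndvd : ¬ f ∣ q := by
        rintro ⟨g, rfl⟩
        exact hne (by simp [hα])
      obtain ⟨u, v, huv⟩ := (hirr.coprime_iff_not_dvd).2 hndvd
      refine not_dvd_one_add_of_mem_weightedSumSq hf ih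
        (mul_mem (mul_mem hr hq) (sq_mem_weightedSumSq v)) ?_
      refine hirr.dvd_of_aeval_eq_zero hα ?_
      have h1 : aeval α v * aeval α q = 1 := by simpa [hα] using congrArg (aeval α) huv
      have h2 : aeval α r = -aeval α q := hqr
      simp only [map_add, map_one, map_mul, map_pow, h2]
      linear_combination (-1 - aeval α v * aeval α q) * h1
    · rintro _ ⟨q, hq, rfl⟩ _ ⟨r, hr, rfl⟩
      exact ⟨(q - r) ^ 2, sq_mem_weightedSumSq _, by simp⟩
  have hsq (g : E[X]) : aeval α g ^ 2 ∈ E :=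
    hPE _ (hP.le_of_ge hQ hPQ ⟨g ^ 2, sq_mem_weightedSumSq g, by simp⟩)
  have h4 : (4 : Ω) ∈ E := natCast_mem E 4
  have h4' : (4 : Ω) ≠ 0 := fun h =>
    four_ne_zero (α := E) (Subtype.ext h)
  have hαE : α ∈ E := by
    have h1 := hsq (X + 1)
    have h2 := hsq (X - 1)
    have h3 : α = ((α + 1) ^ 2 - (α - 1) ^ 2) / 4 := by
      field_simp
      ring
    rw [h3]
    exact div_mem (sub_mem (by simpa using h1) (by simpa using h2)) h4
  refine ⟨⟨α, hαE⟩, Subtype.ext ?_⟩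
  refine Eq.trans ?_ hα
  exact (aeval_algebraMap_apply Ω (⟨α, hαE⟩ : E) f).symm

theorem hasPolynomialIVT_of_maximal [IsAlgClosed Ω] (hP : Maximal IsSquareCone P)
    {E : Subfield Ω} [LinearOrder E] [IsStrictOrderedRing E] (hPE : ∀ x ∈ P, x ∈ E)
    (hE : ∀ x : E, 0 ≤ x ↔ (x : Ω) ∈ P) : HasPolynomialIVT E := by
  intro f a b hab
  induction hd : f.natDegree using Nat.strong_induction_on generalizing f with
  | _ d ih =>
  subst hd
  intro hf
  have hf0 : f ≠ 0 := fun h => by simp [h] at hf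
  have descend {g h : E[X]} (hgh : f = g * h) (hg : 0 < g.natDegree) (hh : 0 < h.natDegree) :
      ∃ c ∈ Set.Ioo a b, f.eval c = 0 := by
    have hg0 : g ≠ 0 := fun h => by simp [h] at hg
    have hh0 : h ≠ 0 := fun h => by simp [h] at hh
    have hdeg : f.natDegree = g.natDegree + h.natDegree := by rw [hgh, natDegree_mul hg0 hh0]
    rw [hgh] at hf
    rcases eval_mul_eval_neg_or_of_mul hf with h' | h'
    · obtain ⟨c, hc, h0⟩ := ih _ (by omega) g rfl h'
      exact ⟨c, hc, by rw [hgh, eval_mul, h0, zero_mul]⟩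
    · obtain ⟨c, hc, h0⟩ := ih _ (by omega) h rfl h'
      exact ⟨c, hc, by rw [hgh, eval_mul, h0, mul_zero]⟩
  have hfd := natDegree_pos_of_eval_mul_eval_neg hf
  by_cases hirr : Irreducible f
  · obtain ⟨α, hα⟩ := IsAlgClosed.exists_aeval_eq_zero Ω f (natDegree_pos_iff_degree_pos.1 hfd).ne'
    obtain ⟨c, hc⟩ := exists_root_of_irreducible_of_maximal hP hPE hE hirr hf
      (fun h hh hneg => (ih _ hh h rfl hneg).imp fun c hc => hc.2) hα
    by_cases hcab : c ∈ Set.Ioo a b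
    · exact ⟨c, hcab, hc⟩
    obtain ⟨g, hg⟩ := dvd_iff_isRoot.2 hc
    have hg0 : 0 < g.natDegree := by
      have hlin : ¬ (X - C c).eval a * (X - C c).eval b < 0 := by
        simp only [eval_sub, eval_X, eval_C, not_lt]
        rcases le_or_gt c a with h | h
        · exact mul_nonneg (by linarith) (by linarith)
        · have : b ≤ c := not_lt.1 fun h' => hcab ⟨h, h'⟩
          exact mul_nonneg_of_nonpos_of_nonpos (by linarith) (by linarith)
      refine natDegree_pos_of_eval_mul_eval_neg (a := a) (b := b) ?_
      exact (eval_mul_eval_neg_or_of_mul (hg ▸ hf)).resolve_left hlin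
    exact descend hg (by simp) hg0
  · have hunit : ¬ IsUnit f := fun h => hfd.ne' (natDegree_eq_zero_of_isUnit h)
    rw [irreducible_iff, not_and] at hirr
    have := hirr hunit
    push Not at this
    obtain ⟨g, h, hgh, hg, hh⟩ := this
    have hg0 : g ≠ 0 := fun h => hf0 (by rw [hgh, h, zero_mul])
    have hh0 : h ≠ 0 := fun h => hf0 (by rw [hgh, h, mul_zero])
    exact descend hgh
      (natDegree_pos_iff_degree_pos.2 (degree_pos_of_ne_zero_of_nonunit hg0 hg))
      (natDegree_pos_iff_degree_pos.2 (degree_pos_of_ne_zero_of_nonunit hh0 hh))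

end RealClosedExtension

section Artin

universe u

theorem IsSumSq.div {F : Type*} [Field F] {a b : F} (ha : IsSumSq a) (hb : IsSumSq b) :
    IsSumSq (a / b) := by
  rcases eq_or_ne b 0 with rfl | h
  · simp
  · have : a / b = a * b * (b⁻¹ * b⁻¹) := by field_simp
    rw [this]
    exact (ha.mul hb).mul (.mul_self _)

theorem isSumSq_of_isSumSq_neg_one {F : Type*} [Field F] [CharZero F]
    (h : IsSumSq (-1 : F)) (p : F) : IsSumSq p := by
  have : p = ((p + 1) / 2) * ((p + 1) / 2) + -1 * (((p - 1) / 2) * ((p - 1) / 2)) := by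
    field_simp
    ring
  rw [this]
  exact (IsSumSq.mul_self _).add (h.mul (.mul_self _))

theorem eq_zero_of_isSumSq_add_eq_zero {F : Type*} [Field F] (h : ¬ IsSumSq (-1 : F)) {a b : F}
    (ha : IsSumSq a) (hb : IsSumSq b) (hab : a + b = 0) : a = 0 := by
  by_contra h0
  refine h ?_
  have : b / a = -1 := by
    field_simp
    linear_combination hab
  exact this ▸ hb.div ha

/-- The sums of squares of `F`, together with `-p`, generate a square cone. -/
theorem exists_isSquareCone_neg_mem {F Ω : Type*} [Field F] [CharZero F] [Field Ω] (j : F →+* Ω)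
    {p : F} (hp : ¬ IsSumSq p) : ∃ P : Subsemiring Ω, IsSquareCone P ∧
      (∀ x, j x ^ 2 ∈ P) ∧ j (-p) ∈ P := by
  have h1 : ¬ IsSumSq (-1 : F) := fun h => hp (isSumSq_of_isSumSq_neg_one h p)
  let Q : Subsemiring F :=
    { carrier := {z | ∃ s t, IsSumSq s ∧ IsSumSq t ∧ z = s - t * p}
      mul_mem' := by
        rintro _ _ ⟨s, t, hs, ht, rfl⟩ ⟨u, v, hu, hv, rfl⟩
        exact ⟨s * u + t * v * (p * p), s * v + t * u,
          (hs.mul hu).add ((ht.mul hv).mul (.mul_self p)), (hs.mul hv).add (ht.mul hu), by ring⟩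
      one_mem' := ⟨1, 0, by simp, by simp, by simp⟩
      add_mem' := by
        rintro _ _ ⟨s, t, hs, ht, rfl⟩ ⟨u, v, hu, hv, rfl⟩
        exact ⟨s + u, t + v, hs.add hu, ht.add hv, by ring⟩
      zero_mem' := ⟨0, 0, by simp, by simp, by simp⟩ }
  have hsq (x : F) : x ^ 2 ∈ Q := ⟨x * x, 0, .mul_self x, .zero, by ring⟩
  refine ⟨Q.map j, ⟨?_, ?_⟩, fun x => ⟨x ^ 2, hsq x, by simp⟩,
    ⟨-p, ⟨0, 1, by simp, by simp, by simp⟩, rfl⟩⟩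
  · rintro _ ⟨x, ⟨s, t, hs, ht, rfl⟩, rfl⟩ ⟨y, ⟨u, v, hu, hv, rfl⟩, hxy⟩
    have h : s + u = (t + v) * p := by
      rw [← map_neg] at hxy
      linear_combination j.injective hxy
    have htv : t + v = 0 := by
      by_contra h0
      refine hp ?_
      rw [eq_div_of_mul_eq h0 ((mul_comm _ _).trans h.symm)]
      exact (hs.add hu).div (ht.add hv)
    have ht0 := eq_zero_of_isSumSq_add_eq_zero h1 ht hv htv
    have hs0 := eq_zero_of_isSumSq_add_eq_zero h1 hs hu (by rw [h, htv, zero_mul])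
    simp [ht0, hs0]
  · rintro _ ⟨x, -, rfl⟩ _ ⟨y, -, rfl⟩
    exact ⟨(x - y) ^ 2, hsq _, by simp⟩

/-- A field element which is not a sum of squares is negative in some ordered extension field with
the intermediate value property. -/
theorem exists_ordered_extension_neg {F : Type u} [Field F] [CharZero F] {p : F}
    (hp : ¬ IsSumSq p) : ∃ (R : Type u) (_ : Field R) (_ : LinearOrder R)
      (_ : IsStrictOrderedRing R) (j : F →+* R), HasPolynomialIVT R ∧ j p < 0 := by
  obtain ⟨P₀, hP₀, hsq, hneg⟩ :=
    exists_isSquareCone_neg_mem (algebraMap F (AlgebraicClosure F)) hp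
  obtain ⟨P, hle, hP⟩ := hP₀.exists_maximal
  obtain ⟨E, _, _, hPE, hE⟩ := exists_ordered_subfield_of_maximal hP
  have hmem (x : F) : algebraMap F (AlgebraicClosure F) x ∈ E := by
    have h : x = ((x + 1) ^ 2 - (x - 1) ^ 2) / 4 := by ring
    rw [h, map_div₀, map_sub, map_pow, map_pow, map_ofNat]
    exact div_mem (sub_mem (hPE _ (hle (hsq _))) (hPE _ (hle (hsq _)))) (ofNat_mem E 4)
  let j : F →+* E := (algebraMap F (AlgebraicClosure F)).codRestrict E hmem
  have hj : 0 ≤ j (-p) := (hE _).2 (hle hneg)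
  have hp0 : p ≠ 0 := fun h => hp (h ▸ .zero)
  refine ⟨E, inferInstance, inferInstance, inferInstance, j,
    hasPolynomialIVT_of_maximal hP hPE hE, lt_of_le_of_ne ?_ ?_⟩
  · rwa [map_neg, neg_nonneg] at hj
  · rwa [_root_.map_ne_zero]

/-- **Artin's solution of Hilbert's 17th problem**: a real polynomial which is nonnegative
everywhere is a sum of squares of rational functions. -/
theorem isSumSq_algebraMap_of_nonneg {n : ℕ} {p : MvPolynomial (Fin n) ℝ}
    (hp : ∀ x, 0 ≤ MvPolynomial.eval x p) :
    IsSumSq (algebraMap (MvPolynomial (Fin n) ℝ) (FractionRing (MvPolynomial (Fin n) ℝ)) p) := by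
  set F := FractionRing (MvPolynomial (Fin n) ℝ)
  have : CharZero F := charZero_of_injective_algebraMap (R := MvPolynomial (Fin n) ℝ)
    (IsFractionRing.injective _ _)
  by_contra h
  obtain ⟨R, _, _, _, j, hR, hneg⟩ := exists_ordered_extension_neg h
  let φ : MvPolynomial (Fin n) ℝ →+* R := j.comp (algebraMap _ F)
  obtain ⟨x, hx⟩ := exists_real_point_sign_eq hR (φ.comp MvPolynomial.C) n
    (fun i => φ (MvPolynomial.X i)) {p}
  have hφ : MvPolynomial.eval₂Hom (φ.comp MvPolynomial.C) (fun i => φ (MvPolynomial.X i)) = φ :=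
    MvPolynomial.ringHom_ext (by simp) (by simp)
  have h1 := hx p (Finset.mem_singleton_self p)
  rw [hφ, sign_neg (show φ p < 0 from hneg), sign_eq_neg_one_iff] at h1
  exact h1.not_ge (hp x)

end Artin

end RealAlgebra

section MatrixPolynomials

/-- Diagonalization of a symmetric matrix by congruence, as a sum of rank one matrices. -/
theorem Matrix.IsSymm.exists_eq_sum_smul_vecMulVec {F ι : Type*} [Field F] [Invertible (2 : F)]
    [Fintype ι] [DecidableEq ι] {M : Matrix ι ι F} (hM : M.IsSymm) :
    ∃ (m : ℕ) (v w : Fin m → ι → F), M = ∑ i, (v i ⬝ᵥ M *ᵥ v i) • vecMulVec (w i) (w i) := by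
  obtain ⟨v, hv⟩ :=
    LinearMap.BilinForm.exists_orthogonal_basis (LinearMap.BilinForm.isSymm_iff.1 (isSymm_toBilin'_iff_isSymm.2 hM))
  refine ⟨_, v, fun i k => v.repr (Pi.single k 1) i, ?_⟩
  ext k l
  rw [← toBilin'_single M k l, ← LinearMap.sum_repr_mul_repr_mul v v,
    Finsupp.sum_fintype _ _ (by simp)]
  rw [sum_apply]
  refine Finset.sum_congr rfl fun i _ => ?_
  rw [Finsupp.sum_fintype _ _ (by simp), Finset.sum_eq_single i]
  · simp only [smul_apply, vecMulVec_apply, smul_eq_mul, toBilin'_apply']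
    ring
  · intro j _ hj
    rw [show M.toBilin' (v i) (v j) = 0 from hv hj.symm]
    simp
  · simp

variable {n t : ℕ}

theorem IsSOHS.zero : IsSOHS n t 0 := ⟨0, Fin.elim0, by simp⟩

theorem IsSOHS.add {A A' : Matrix (Fin t) (Fin t) (MvPolynomial (Fin n) ℝ)} (hA : IsSOHS n t A)
    (hA' : IsSOHS n t A') : IsSOHS n t (A + A') := by
  obtain ⟨N, B, rfl⟩ := hA
  obtain ⟨N', B', rfl⟩ := hA'
  exact ⟨N + N', Fin.append B B', by simp [Fin.sum_univ_add]⟩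

theorem IsSOHS.sq_smul {A : Matrix (Fin t) (Fin t) (MvPolynomial (Fin n) ℝ)} (hA : IsSOHS n t A)
    (p : MvPolynomial (Fin n) ℝ) : IsSOHS n t (p ^ 2 • A) := by
  obtain ⟨N, B, rfl⟩ := hA
  refine ⟨N, fun i => p • B i, ?_⟩
  simp [Finset.smul_sum, smul_smul, sq]

theorem IsSOHS.vecMulVec (u : Fin t → MvPolynomial (Fin n) ℝ) :
    IsSOHS n t (Matrix.vecMulVec u u) := by
  rcases isEmpty_or_nonempty (Fin t) with h | ⟨⟨r⟩⟩
  · rw [Subsingleton.elim (Matrix.vecMulVec u u) 0]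
    exact .zero
  · refine ⟨1, fun _ => Matrix.vecMulVec (Pi.single r 1) u, ?_⟩
    simp [transpose_vecMulVec, vecMulVec_mul_vecMulVec]

/-- The matrices over the field of rational functions which become sums of hermitian squares of
polynomial matrices after multiplication by the square of a nonzero polynomial. -/
def IsRationalSOHS (n t : ℕ)
    (M : Matrix (Fin t) (Fin t) (FractionRing (MvPolynomial (Fin n) ℝ))) : Prop :=
  ∃ (p : MvPolynomial (Fin n) ℝ) (A : Matrix (Fin t) (Fin t) (MvPolynomial (Fin n) ℝ)),
    p ≠ 0 ∧ IsSOHS n t A ∧ algebraMap _ (FractionRing (MvPolynomial (Fin n) ℝ)) (p ^ 2) • M =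
      A.map (algebraMap _ _)

variable {M M' : Matrix (Fin t) (Fin t) (FractionRing (MvPolynomial (Fin n) ℝ))}

theorem IsRationalSOHS.zero : IsRationalSOHS n t 0 := ⟨1, 0, one_ne_zero, .zero, by simp⟩

theorem IsRationalSOHS.add (hM : IsRationalSOHS n t M) (hM' : IsRationalSOHS n t M') :
    IsRationalSOHS n t (M + M') := by
  obtain ⟨p, A, hp, hA, h⟩ := hM
  obtain ⟨p', A', hp', hA', h'⟩ := hM'
  refine ⟨p * p', p' ^ 2 • A + p ^ 2 • A', mul_ne_zero hp hp',
    (hA.sq_smul p').add (hA'.sq_smul p), ?_⟩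
  rw [Matrix.map_add _ (map_add _), Matrix.map_smul' _ _ _ (map_mul _),
    Matrix.map_smul' _ _ _ (map_mul _), ← h, ← h', smul_smul, smul_smul, smul_add, ← map_mul,
    ← map_mul, mul_pow, mul_comm (p' ^ 2)]

theorem IsRationalSOHS.vecMulVec (c : Fin t → FractionRing (MvPolynomial (Fin n) ℝ)) :
    IsRationalSOHS n t (Matrix.vecMulVec c c) := by
  obtain ⟨b, hb⟩ := IsLocalization.exist_integer_multiples_of_finite
    (nonZeroDivisors (MvPolynomial (Fin n) ℝ)) c
  choose u hu using hb
  refine ⟨b, _, nonZeroDivisors.ne_zero b.2, .vecMulVec u, ?_⟩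
  ext i j
  simp only [Matrix.smul_apply, smul_eq_mul, map_apply, vecMulVec_apply, map_mul, map_pow, hu,
    Algebra.smul_def]
  ring

theorem IsRationalSOHS.smul_vecMulVec {d : FractionRing (MvPolynomial (Fin n) ℝ)}
    (hd : IsSumSq d) (w : Fin t → FractionRing (MvPolynomial (Fin n) ℝ)) :
    IsRationalSOHS n t (d • Matrix.vecMulVec w w) := by
  induction hd with
  | zero => simpa using IsRationalSOHS.zero
  | sq_add a _ ih =>
    rw [add_smul]
    refine .add ?_ ih
    rw [show (a * a) • Matrix.vecMulVec w w = Matrix.vecMulVec (a • w) (a • w) by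
      rw [Matrix.smul_vecMulVec, vecMulVec_smul, smul_smul]]
    exact .vecMulVec _

variable {f : Matrix (Fin t) (Fin t) (MvPolynomial (Fin n) ℝ)}

theorem eval_dotProduct_mulVec (x : Fin n → ℝ) (u : Fin t → MvPolynomial (Fin n) ℝ) :
    MvPolynomial.eval x (u ⬝ᵥ f *ᵥ u) =
      (MvPolynomial.eval x ∘ u) ⬝ᵥ f.map (MvPolynomial.eval x) *ᵥ (MvPolynomial.eval x ∘ u) := by
  rw [RingHom.map_dotProduct]
  congr 1
  funext i
  exact RingHom.map_mulVec _ f u i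

theorem isSumSq_dotProduct_mulVec (hf : ∀ x, (f.map (MvPolynomial.eval x)).PosSemidef)
    (v : Fin t → FractionRing (MvPolynomial (Fin n) ℝ)) :
    IsSumSq (v ⬝ᵥ f.map (algebraMap _ _) *ᵥ v) := by
  obtain ⟨b, hb⟩ := IsLocalization.exist_integer_multiples_of_finite
    (nonZeroDivisors (MvPolynomial (Fin n) ℝ)) v
  choose u hu using hb
  set β := algebraMap _ (FractionRing (MvPolynomial (Fin n) ℝ)) b.1
  have hβ : β ≠ 0 := IsFractionRing.to_map_ne_zero_of_mem_nonZeroDivisors b.2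
  have hu' : algebraMap _ (FractionRing (MvPolynomial (Fin n) ℝ)) ∘ u = β • v := by
    funext i
    rw [Function.comp_apply, hu, Algebra.smul_def]
    rfl
  have hS : IsSumSq (algebraMap _ (FractionRing (MvPolynomial (Fin n) ℝ)) (u ⬝ᵥ f *ᵥ u)) := by
    refine isSumSq_algebraMap_of_nonneg fun x => ?_
    rw [eval_dotProduct_mulVec]
    simpa using (hf x).dotProduct_mulVec_nonneg (MvPolynomial.eval x ∘ u)
  have hmap : algebraMap _ (FractionRing (MvPolynomial (Fin n) ℝ)) (u ⬝ᵥ f *ᵥ u) =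
      (β • v) ⬝ᵥ f.map (algebraMap _ _) *ᵥ (β • v) := by
    rw [RingHom.map_dotProduct, hu']
    congr 1
    funext i
    rw [← hu']
    exact RingHom.map_mulVec _ f u i
  have : v ⬝ᵥ f.map (algebraMap _ _) *ᵥ v = (β⁻¹ * β⁻¹) *
      algebraMap _ (FractionRing (MvPolynomial (Fin n) ℝ)) (u ⬝ᵥ f *ᵥ u) := by
    rw [hmap, mulVec_smul, smul_dotProduct, dotProduct_smul, smul_eq_mul, smul_eq_mul]
    field_simp
  rw [this]
  exact (IsSumSq.mul_self _).mul hS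

theorem exists_isSOHS_of_posSemidef (hsymm : fᵀ = f)
    (hf : ∀ x, (f.map (MvPolynomial.eval x)).PosSemidef) :
    ∃ p : MvPolynomial (Fin n) ℝ, p ≠ 0 ∧ IsSOHS n t (p ^ 2 • f) := by
  set F := FractionRing (MvPolynomial (Fin n) ℝ)
  have hinj : Function.Injective (algebraMap (MvPolynomial (Fin n) ℝ) F) :=
    IsFractionRing.injective _ _
  have : CharZero F := charZero_of_injective_algebraMap hinj
  have : Invertible (2 : F) := invertibleOfNonzero two_ne_zero
  have hM : (f.map (algebraMap _ F)).IsSymm := by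
    rw [IsSymm, ← transpose_map, hsymm]
  obtain ⟨m, v, w, hvw⟩ := hM.exists_eq_sum_smul_vecMulVec
  have hrat : IsRationalSOHS n t (f.map (algebraMap _ F)) := by
    rw [hvw]
    exact Finset.sum_induction _ (IsRationalSOHS n t) (fun _ _ => .add) .zero
      fun i _ => .smul_vecMulVec (isSumSq_dotProduct_mulVec hf (v i)) (w i)
  obtain ⟨p, A, hp, hA, h⟩ := hrat
  rw [← Matrix.map_smul' _ _ _ (map_mul _)] at h
  exact ⟨p, hp, by rwa [Matrix.map_injective hinj h]⟩

theorem eval_nonneg_of_sq_mul {p g : MvPolynomial (Fin n) ℝ} (hp : p ≠ 0)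
    (h : ∀ x, 0 ≤ MvPolynomial.eval x (p ^ 2 * g)) (x : Fin n → ℝ) :
    0 ≤ MvPolynomial.eval x g := by
  by_contra! hx
  have hopen : IsOpen {y | MvPolynomial.eval y g < 0} :=
    isOpen_lt (MvPolynomial.continuous_eval g) continuous_const
  obtain ⟨s, hs, hsub⟩ := isOpen_pi_iff'.1 hopen x hx
  refine hp (MvPolynomial.funext_set s (fun i => ?_) fun y hy => ?_)
  · exact infinite_of_mem_nhds (x i) ((hs i).1.mem_nhds (hs i).2)
  · have hy' : MvPolynomial.eval y g < 0 := hsub hy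
    have := h y
    rw [map_mul, map_pow] at this
    rw [map_zero]
    by_contra h0
    exact (mul_neg_of_pos_of_neg (by positivity) hy').not_ge this

theorem posSemidef_of_isSOHS (hsymm : fᵀ = f) {p : MvPolynomial (Fin n) ℝ} (hp : p ≠ 0)
    (h : IsSOHS n t (p ^ 2 • f)) (x : Fin n → ℝ) : (f.map (MvPolynomial.eval x)).PosSemidef := by
  refine .of_dotProduct_mulVec_nonneg ?_ fun y => ?_
  · rw [IsHermitian, conjTranspose_eq_transpose_of_trivial, ← transpose_map, hsymm]
  obtain ⟨N, B, hB⟩ := h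
  have hC : MvPolynomial.eval x ∘ (fun i => MvPolynomial.C (y i)) = y := by
    funext i
    simp
  have key := eval_nonneg_of_sq_mul (g := (fun i => MvPolynomial.C (y i)) ⬝ᵥ f *ᵥ
    fun i => MvPolynomial.C (y i)) hp (fun z => ?_) x
  · rwa [eval_dotProduct_mulVec, hC] at key
  · rw [← smul_eq_mul, ← dotProduct_smul, ← smul_mulVec, hB, sum_mulVec, dotProduct_sum, map_sum]
    refine Finset.sum_nonneg fun i _ => ?_
    rw [← mulVec_mulVec, dotProduct_mulVec, vecMul_transpose, RingHom.map_dotProduct]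
    exact Finset.sum_nonneg fun j _ => mul_self_nonneg _

end MatrixPolynomials

/-- **Gondard–Ribenboim.** A symmetric matrix polynomial `f` is positive semidefinite at
every point of `ℝⁿ` if and only if `p² f` is a sum of hermitian squares for some nonzero
polynomial `p`. -/
theorem stmt3 (n t : ℕ) (f : Matrix (Fin t) (Fin t) (MvPolynomial (Fin n) ℝ))
    (hf : fᵀ = f) :
    (∀ x : Fin n → ℝ, (f.map (MvPolynomial.eval x)).PosSemidef) ↔
      ∃ p : MvPolynomial (Fin n) ℝ, p ≠ 0 ∧ IsSOHS n t (p ^ 2 • f) :=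
  ⟨exists_isSOHS_of_posSemidef hf, fun ⟨_, hp, h⟩ => posSemidef_of_isSOHS hf hp h⟩
end

section
/- If a symmetric matrix polynomial f ∈ ℝ[Z]^{t×t} in one variable satisfies f(z) ⪰ 0 for all z ∈ ℝ, then f is a sum of two hermitian squares in ℝ[Z]^{t×t}; conversely a sum of hermitian squares is everywhere positive semidefinite. -/
open Matrix

namespace Jakubovic

open Polynomial
open scoped ComplexOrder

/-- The involution on `ℂ[X]` conjugating all coefficients. -/
noncomputable instance : StarRing ℂ[X] where
  star p := p.map (starRingEnd ℂ)
  star_involutive p := by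
    change (p.map _).map _ = p
    rw [Polynomial.map_map]
    convert Polynomial.map_id
    ext z
    simp
  star_mul p q := by
    change (p * q).map _ = q.map _ * p.map _
    rw [Polynomial.map_mul, mul_comm]
  star_add p q := Polynomial.map_add _

lemma star_eq_map (p : ℂ[X]) : star p = p.map (starRingEnd ℂ) := rfl

lemma star_C (c : ℂ) : star (C c) = C (star c) := Polynomial.map_C _

lemma star_X : star (X : ℂ[X]) = X := Polynomial.map_X _

lemma eval_star (p : ℂ[X]) (z : ℂ) : (star p).eval (star z) = star (p.eval z) := by
  rw [star_eq_map, eval_map]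
  exact eval₂_at_apply (starRingEnd ℂ) z

/-- The embedding of `ℝ[X]` into `ℂ[X]`. -/
noncomputable def toComplex : ℝ[X] →+* ℂ[X] := mapRingHom (algebraMap ℝ ℂ)

lemma toComplex_injective : Function.Injective toComplex :=
  Polynomial.map_injective _ (algebraMap ℝ ℂ).injective

lemma star_toComplex (p : ℝ[X]) : star (toComplex p) = toComplex p := by
  ext n
  simp [star_eq_map, toComplex]

lemma coeff_toComplex (p : ℝ[X]) (n : ℕ) : (toComplex p).coeff n = (p.coeff n : ℂ) := by
  simp [toComplex]

/-- A complex matrix has an orthogonal projection onto its column space. -/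
lemma exists_projection {n : Type*} [Fintype n] [DecidableEq n] (A : Matrix n n ℂ) :
    ∃ P Y : Matrix n n ℂ, Pᴴ = P ∧ P * P = P ∧ P * A = A ∧ P = A * Y := by
  have hB : (Aᴴ * A).IsHermitian := isHermitian_conjTranspose_mul_self A
  obtain ⟨U, d, hU, hd, hspec⟩ : ∃ (U : Matrix n n ℂ) (d : n → ℂ),
      Uᴴ * U = 1 ∧ star d = d ∧ Aᴴ * A = U * diagonal d * Uᴴ := by
    refine ⟨hB.eigenvectorUnitary, fun i => (hB.eigenvalues i : ℂ), ?_, ?_, ?_⟩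
    · exact Unitary.coe_star_mul_self hB.eigenvectorUnitary
    · ext i; simp
    · conv_lhs => rw [hB.spectral_theorem]
      rfl
  set e : Matrix n n ℂ := diagonal d⁻¹ with he
  have heH : eᴴ = e := by
    rw [he, diagonal_conjTranspose]
    congr 1
    ext1 i
    have := congrFun hd i
    simp only [Pi.star_apply] at this
    simp only [Pi.star_apply, Pi.inv_apply, star_inv₀, this]
  have hded : diagonal d * e * diagonal d = diagonal d := by
    simp only [he, diagonal_mul_diagonal]
    congr 1; ext i
    by_cases h : d i = 0 <;> simp [h]
  have hede : e * diagonal d * e = e := by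
    simp only [he, diagonal_mul_diagonal]
    congr 1; ext i
    by_cases h : d i = 0 <;> simp [h]
  set G : Matrix n n ℂ := U * e * Uᴴ with hG
  have hGH : Gᴴ = G := by simp [hG, heH, Matrix.mul_assoc]
  have key (x y : Matrix n n ℂ) : U * x * Uᴴ * (U * y * Uᴴ) = U * (x * y) * Uᴴ := by
    calc _ = U * x * (Uᴴ * U) * y * Uᴴ := by simp only [Matrix.mul_assoc]
      _ = _ := by rw [hU]; simp only [Matrix.mul_assoc, Matrix.one_mul]
  have hBGB : Aᴴ * A * G * (Aᴴ * A) = Aᴴ * A := by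
    rw [hspec, hG, key, key, hded]
  have hGBG : G * (Aᴴ * A) * G = G := by
    rw [hspec, hG, key, key, hede]
  have hAGB : A * G * (Aᴴ * A) = A := by
    rw [← sub_eq_zero, ← conjTranspose_mul_self_eq_zero]
    have : (A * G * (Aᴴ * A) - A)ᴴ * (A * G * (Aᴴ * A) - A) =
        (Aᴴ * A * G - 1) * (Aᴴ * A * G * (Aᴴ * A) - Aᴴ * A) := by
      simp only [conjTranspose_sub, conjTranspose_mul, conjTranspose_conjTranspose, hGH]
      noncomm_ring
    rw [this, hBGB, sub_self, Matrix.mul_zero]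
  refine ⟨A * (G * Aᴴ), G * Aᴴ, ?_, ?_, ?_, rfl⟩
  · simp [hGH, Matrix.mul_assoc]
  · calc A * (G * Aᴴ) * (A * (G * Aᴴ)) = A * (G * (Aᴴ * A) * G) * Aᴴ := by
          simp only [Matrix.mul_assoc]
      _ = _ := by rw [hGBG, Matrix.mul_assoc]
  · simpa only [Matrix.mul_assoc] using hAGB

section Divide

variable {n : Type*}

/-- Entrywise evaluation of a polynomial matrix. -/
noncomputable def evalMat (z : ℂ) (F : Matrix n n ℂ[X]) : Matrix n n ℂ :=
  F.map (evalRingHom z)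

lemma evalMat_mul [Fintype n] (z : ℂ) (F G : Matrix n n ℂ[X]) :
    evalMat z (F * G) = evalMat z F * evalMat z G :=
  Matrix.map_mul

lemma evalMat_map_C (z : ℂ) (P : Matrix n n ℂ) : evalMat z (P.map C) = P := by
  ext i j
  simp [evalMat]

lemma evalMat_conjTranspose (z : ℂ) (F : Matrix n n ℂ[X]) :
    evalMat z Fᴴ = (evalMat (star z) F)ᴴ := by
  ext i j
  have := eval_star (F j i) (star z)
  rw [star_star] at this
  simpa [evalMat] using this

lemma exists_smul_of_evalMat_eq_zero {z : ℂ} {F : Matrix n n ℂ[X]} (h : evalMat z F = 0) :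
    ∃ G : Matrix n n ℂ[X], F = (X - C z) • G := by
  have h' (i j) : ∃ g, F i j = (X - C z) * g :=
    dvd_iff_isRoot.mpr (congrFun (congrFun h i) j)
  choose G hG using h'
  exact ⟨of G, by ext1 i j; simpa using hG i j⟩

lemma smul_matrix_cancel {p : ℂ[X]} (hp : p ≠ 0) {F G : Matrix n n ℂ[X]}
    (h : p • F = p • G) : F = G := by
  ext1 i j
  exact mul_left_cancel₀ hp (by simpa using congrFun (congrFun h i) j)

/-- A linear factor of the denominator of a hermitian square can be removed. -/
lemma exists_hermitian_square_of_linear [Fintype n] [DecidableEq n] {z : ℂ} {F N : Matrix n n ℂ[X]}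
    (h : Fᴴ * F = ((X - C (star z)) * (X - C z)) • N) :
    ∃ G : Matrix n n ℂ[X], N = Gᴴ * G := by
  obtain ⟨P, Y, hPH, hPP, hPA, hPY⟩ := exists_projection (evalMat z F)
  have hzero : (evalMat (star z) F)ᴴ * evalMat z F = 0 := by
    rw [← evalMat_conjTranspose, ← evalMat_mul, h]
    ext i j
    simp [evalMat]
  have hQH : (P.map C)ᴴ = P.map C := by
    conv_rhs => rw [← hPH]
    ext1 i j
    simp [star_C]
  have hQQ : P.map C * P.map C = P.map C := by
    rw [← Matrix.map_mul, hPP]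
  set Q : Matrix n n ℂ[X] := P.map C with hQ
  obtain ⟨G₁, hG₁⟩ := exists_smul_of_evalMat_eq_zero (z := z) (F := F - Q * F) (by
    have : evalMat z (F - Q * F) = evalMat z F - evalMat z (Q * F) := by
      ext i j; simp [evalMat]
    rw [this, evalMat_mul, hQ, evalMat_map_C, hPA, sub_self])
  obtain ⟨G₂, hG₂⟩ := exists_smul_of_evalMat_eq_zero (z := star z) (F := Q * F) (by
    rw [evalMat_mul, hQ, evalMat_map_C, ← conjTranspose_eq_zero, conjTranspose_mul, hPH, hPY,
      ← Matrix.mul_assoc, hzero, Matrix.zero_mul])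
  have hs : star (X - C z) = X - C (star z) := by rw [star_sub, star_X, star_C]
  have hs' : star (X - C (star z)) = X - C z := by rw [star_sub, star_X, star_C, star_star]
  have horth : (F - Q * F)ᴴ * (Q * F) = 0 := by
    rw [conjTranspose_sub, conjTranspose_mul, hQH, Matrix.sub_mul, Matrix.mul_assoc,
      ← Matrix.mul_assoc Q Q, hQQ, sub_self]
  have h12 : G₁ᴴ * G₂ = 0 := by
    rw [hG₁, hG₂, conjTranspose_smul, hs, smul_mul_smul_comm] at horth
    exact smul_matrix_cancel (mul_ne_zero (X_sub_C_ne_zero _) (X_sub_C_ne_zero _))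
      (horth.trans (smul_zero _).symm)
  have h21 : G₂ᴴ * G₁ = 0 := by
    rw [← conjTranspose_eq_zero, conjTranspose_mul, conjTranspose_conjTranspose, h12]
  refine ⟨G₁ + G₂, smul_matrix_cancel
    (mul_ne_zero (X_sub_C_ne_zero (star z)) (X_sub_C_ne_zero z)) ?_⟩
  have hF : F = (X - C z) • G₁ + (X - C (star z)) • G₂ := by rw [← hG₁, ← hG₂]; abel
  rw [← h, hF]
  simp only [conjTranspose_add, conjTranspose_smul, hs, hs', Matrix.add_mul, Matrix.mul_add,
    smul_mul_smul_comm, h12, h21, smul_zero, add_zero, zero_add, smul_add]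
  rw [mul_comm (X - C z)]

/-- Denominators of hermitian squares can be removed. -/
lemma exists_hermitian_square_of_smul [Fintype n] [DecidableEq n] (h : ℂ[X]) (hh : h ≠ 0)
    (F N : Matrix n n ℂ[X]) (hF : Fᴴ * F = (star h * h) • N) :
    ∃ G : Matrix n n ℂ[X], N = Gᴴ * G := by
  induction hd : h.natDegree generalizing h F with
  | zero =>
    obtain ⟨c, rfl⟩ := natDegree_eq_zero.mp hd
    have hc : c ≠ 0 := fun h0 => hh (by simp [h0])
    refine ⟨C c⁻¹ • F, ?_⟩
    rw [conjTranspose_smul, smul_mul_smul_comm, hF, smul_smul, star_C, star_C, ← C_mul, ← C_mul,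
      ← C_mul]
    have : star c⁻¹ * c⁻¹ * (star c * c) = 1 := by
      have : star c ≠ 0 := star_ne_zero.mpr hc
      rw [star_inv₀]; field_simp
    rw [this, C_1, one_smul]
  | succ d ih =>
    obtain ⟨z, hz⟩ := Complex.exists_root (f := h)
      (natDegree_pos_iff_degree_pos.mp (by omega))
    obtain ⟨k, rfl⟩ := dvd_iff_isRoot.mpr hz
    have hk : k ≠ 0 := right_ne_zero_of_mul hh
    obtain ⟨G, hG⟩ := exists_hermitian_square_of_linear (z := z) (F := F)
      (N := (star k * k) • N) (by
        rw [hF, smul_smul, star_mul, star_sub, star_X, star_C]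
        congr 1; ring)
    refine ih k hk G hG.symm ?_
    rw [natDegree_mul (X_sub_C_ne_zero z) hk, natDegree_X_sub_C] at hd
    omega

end Divide

/-- A nonnegative real polynomial is a sum of two squares. -/
lemma exists_sq_add_sq (p : ℝ[X]) (hp : ∀ x, 0 ≤ p.eval x) : ∃ r s : ℝ[X], p = r ^ 2 + s ^ 2 := by
  induction hd : p.natDegree using Nat.strong_induction_on generalizing p with
  | _ d ih =>
  by_cases h0 : p.natDegree = 0
  · obtain ⟨c, rfl⟩ := natDegree_eq_zero.mp h0
    have hc : 0 ≤ c := by simpa using hp 0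
    exact ⟨C √c, 0, by rw [← C_pow, Real.sq_sqrt hc]; simp⟩
  have hp0 : p ≠ 0 := by rintro rfl; simp at h0
  suffices ∃ a b q : ℝ[X], p = (a ^ 2 + b ^ 2) * q ∧ 0 < (a ^ 2 + b ^ 2).natDegree by
    obtain ⟨a, b, q, rfl, hab⟩ := this
    have hq : ∀ x, 0 ≤ q.eval x := by
      have hclosed : IsClosed {x | 0 ≤ q.eval x} := isClosed_le continuous_const q.continuous
      have hdense : Dense {x | (a ^ 2 + b ^ 2).eval x ≠ 0} := by
        exact Set.Countable.dense_compl ℝ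
          (finite_setOfPred_isRoot (left_ne_zero_of_mul hp0)).countable
      intro x
      refine hclosed.closure_subset_iff.mpr ?_ (hdense x)
      intro y hy
      have h1 : 0 ≤ (a ^ 2 + b ^ 2).eval y := by simp only [eval_add, eval_pow]; positivity
      have h2 := hp y
      rw [eval_mul] at h2
      exact nonneg_of_mul_nonneg_right h2 (lt_of_le_of_ne h1 (Ne.symm hy))
    rw [natDegree_mul (left_ne_zero_of_mul hp0) (right_ne_zero_of_mul hp0)] at hd
    obtain ⟨r, s, rfl⟩ := ih q.natDegree (by omega) q hq rfl
    exact ⟨a * r - b * s, a * s + b * r, by ring⟩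
  obtain ⟨z, hz⟩ := IsAlgClosed.exists_aeval_eq_zero ℂ p
    (natDegree_pos_iff_degree_pos.mp (Nat.pos_of_ne_zero h0)).ne'
  by_cases him : z.im = 0
  · obtain ⟨x, rfl⟩ : ∃ x : ℝ, z = x := ⟨z.re, by apply Complex.ext <;> simp [him]⟩
    have hx : p.eval x = 0 := by
      have := aeval_algebraMap_apply ℂ x p
      rw [Complex.coe_algebraMap, hz] at this
      simpa using this.symm
    have hder : p.derivative.eval x = 0 := by
      have hmin : IsLocalMin (fun y => p.eval y) x :=
        Filter.Eventually.of_forall fun y => by simpa [hx] using hp y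
      simpa using hmin.deriv_eq_zero
    obtain ⟨q, rfl⟩ := dvd_iff_isRoot.mpr hx
    have hq : q.eval x = 0 := by simpa using hder
    obtain ⟨q, rfl⟩ := dvd_iff_isRoot.mpr hq
    refine ⟨X - C x, 0, q, by ring, ?_⟩
    simp
  · obtain ⟨q, hq⟩ := quadratic_dvd_of_aeval_eq_zero_im_ne_zero p hz him
    have hquad : (X - C z.re) ^ 2 + (C z.im) ^ 2 = X ^ 2 - C (2 * z.re) * X + C (‖z‖ ^ 2) := by
      rw [← Complex.normSq_eq_norm_sq, Complex.normSq_apply]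
      simp only [C_add, C_mul, C_ofNat]
      ring
    refine ⟨X - C z.re, C z.im, q, by rw [hquad, hq], ?_⟩
    rw [← C_pow, natDegree_add_C]
    simp

/-- A nonnegative real polynomial is a hermitian square over `ℂ`. -/
lemma exists_star_mul_self (p : ℝ[X]) (hp : ∀ x, 0 ≤ p.eval x) :
    ∃ q : ℂ[X], toComplex p = star q * q := by
  obtain ⟨r, s, rfl⟩ := exists_sq_add_sq p hp
  refine ⟨toComplex r + C Complex.I * toComplex s, ?_⟩
  rw [star_add, star_mul, star_toComplex, star_toComplex, star_C]
  have hI : (C Complex.I : ℂ[X]) ^ 2 = -1 := by rw [← C_pow]; simp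
  simp only [map_add, map_pow, Complex.star_def, Complex.conj_I, C_neg]
  linear_combination (toComplex s) ^ 2 * hI

/-- The Schur complement inequality for a positive semidefinite real quadratic form. -/
lemma schur_nonneg {n : ℕ} {M : Matrix (Fin (n + 1)) (Fin (n + 1)) ℝ} (hM : Mᵀ = M)
    (hpos : ∀ v : Fin (n + 1) → ℝ, 0 ≤ v ⬝ᵥ M *ᵥ v) (v : Fin n → ℝ) :
    (∑ i, v i * M 0 i.succ) ^ 2 ≤ M 0 0 * (v ⬝ᵥ M.submatrix Fin.succ Fin.succ *ᵥ v) := by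
  have hs (i : Fin n) : M i.succ 0 = M 0 i.succ := by
    conv_lhs => rw [← hM, transpose_apply]
  have := discrim_le_zero (a := M 0 0) (b := 2 * ∑ i, v i * M 0 i.succ)
    (c := v ⬝ᵥ M.submatrix Fin.succ Fin.succ *ᵥ v) (fun x => by
      refine (hpos (Fin.cons x v)).trans_eq ?_
      simp only [dotProduct, mulVec, Fin.sum_univ_succ, Fin.cons_zero, Fin.cons_succ,
        submatrix_apply, hs, mul_add, Finset.sum_add_distrib, Finset.mul_sum]
      have e1 : ∑ i, v i * (M 0 i.succ * x) = ∑ i, x * (M 0 i.succ * v i) :=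
        Finset.sum_congr rfl fun i _ => by ring
      have e2 : (∑ i, 2 * (v i * M 0 i.succ)) * x = 2 * ∑ i, x * (M 0 i.succ * v i) := by
        rw [Finset.sum_mul, Finset.mul_sum]
        exact Finset.sum_congr rfl fun i _ => by ring
      rw [e1, e2]
      ring)
  rw [discrim] at this
  linarith

/-- A positive semidefinite polynomial matrix is a hermitian square up to a denominator. -/
lemma exists_denominator (n : ℕ) (f : Matrix (Fin n) (Fin n) ℝ[X]) (hf : fᵀ = f)
    (hpos : ∀ (z : ℝ) (v : Fin n → ℝ), 0 ≤ v ⬝ᵥ f.map (eval z) *ᵥ v) :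
    ∃ h : ℝ[X], h ≠ 0 ∧ ∃ F : Matrix (Fin n) (Fin n) ℂ[X],
      (h ^ 2 • f).map toComplex = Fᴴ * F := by
  induction n with
  | zero => exact ⟨1, one_ne_zero, 0, Subsingleton.elim _ _⟩
  | succ n ih =>
    have hs (i j) : f i j = f j i := by
      conv_lhs => rw [← hf, transpose_apply]
    have hfz (z : ℝ) : (f.map (eval z))ᵀ = f.map (eval z) := by
      rw [← hf, ← transpose_map, transpose_transpose, hf]
    have hschur (z : ℝ) := schur_nonneg (hfz z) (hpos z)
    by_cases ha : f 0 0 = 0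
    · have hb (j : Fin n) : f 0 j.succ = 0 := by
        refine Polynomial.funext fun z => ?_
        have := hschur z (Pi.single j 1)
        simpa [ha, Pi.single_apply] using this
      have hb' (j) : f 0 j = 0 := Fin.cases ha hb j
      have hb'' (j) : f j 0 = 0 := by rw [hs, hb']
      obtain ⟨h, hh, G, hG⟩ := ih (f.submatrix Fin.succ Fin.succ)
        (by rw [transpose_submatrix, hf]) (fun z v => by
          have := hpos z (Fin.cons 0 v)
          simpa [dotProduct, mulVec, Fin.sum_univ_succ] using this)
      refine ⟨h, hh, of (Fin.cons 0 fun i => Fin.cons 0 (G i)), ?_⟩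
      ext1 i j
      refine Fin.cases ?_ (fun i => ?_) i
      · simp [hb', Matrix.mul_apply, Fin.sum_univ_succ]
      refine Fin.cases ?_ (fun j => ?_) j
      · simp [hb'', Matrix.mul_apply, Fin.sum_univ_succ]
      have := congrFun (congrFun hG i) j
      simpa [Matrix.mul_apply, Fin.sum_univ_succ] using this
    · set S : Matrix (Fin n) (Fin n) ℝ[X] :=
        of fun i j => f 0 0 * f i.succ j.succ - f 0 i.succ * f 0 j.succ with hS
      obtain ⟨h, hh, G, hG⟩ := ih S (by
          ext1 i j
          simp only [hS, transpose_apply, of_apply]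
          rw [hs j.succ i.succ]
          ring) (fun z v => by
          have h1 := hschur z v
          have h2 : v ⬝ᵥ S.map (eval z) *ᵥ v = (f.map (eval z)) 0 0 *
              (v ⬝ᵥ (f.map (eval z)).submatrix Fin.succ Fin.succ *ᵥ v) -
              (∑ i, v i * (f.map (eval z)) 0 i.succ) ^ 2 := by
            simp only [hS, dotProduct, mulVec, map_apply, of_apply, submatrix_apply, eval_sub,
              eval_mul]
            rw [sq, Finset.sum_mul_sum]
            simp only [Finset.mul_sum, ← Finset.sum_sub_distrib]
            exact Finset.sum_congr rfl fun i _ => Finset.sum_congr rfl fun j _ => by ring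
          rw [h2]
          linarith)
      obtain ⟨q, hq⟩ := exists_star_mul_self (f 0 0) (fun z => by
        have := hpos z (Pi.single 0 1)
        simpa using this)
      refine ⟨f 0 0 * h, mul_ne_zero ha hh,
        of (Fin.cons (fun j => q * toComplex (h * f 0 j)) fun i => Fin.cons 0 (q • G i)), ?_⟩
      have hq' (x y : ℂ[X]) : star (q * x) * (q * y) = toComplex (f 0 0) * (star x * y) := by
        rw [star_mul, hq]; ring
      ext1 i j
      refine Fin.cases ?_ (fun i => ?_) i
      · simp only [map_apply, Matrix.smul_apply, smul_eq_mul, Matrix.mul_apply, conjTranspose_apply,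
          Fin.sum_univ_succ, of_apply, Fin.cons_zero, Fin.cons_succ, hq', star_toComplex]
        simp
        ring
      refine Fin.cases ?_ (fun j => ?_) j
      · simp only [map_apply, Matrix.smul_apply, smul_eq_mul, Matrix.mul_apply, conjTranspose_apply,
          Fin.sum_univ_succ, of_apply, Fin.cons_zero, Fin.cons_succ, hq', star_toComplex]
        rw [hs i.succ 0]
        simp
        ring
      have := congrFun (congrFun hG i) j
      simp only [map_apply, Matrix.smul_apply, smul_eq_mul, Matrix.mul_apply, conjTranspose_apply, hS,
        of_apply] at this
      simp only [map_apply, Matrix.smul_apply, smul_eq_mul, Matrix.mul_apply, conjTranspose_apply,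
        Fin.sum_univ_succ, of_apply, Fin.cons_zero, Fin.cons_succ, hq', star_toComplex,
        Pi.smul_apply, ← Finset.mul_sum, ← this, ← map_mul, ← map_add]
      congr 1
      ring

/-- Splitting a complex polynomial into real and imaginary parts. -/
lemma exists_re_im (p : ℂ[X]) : ∃ r s : ℝ[X], p = toComplex r + C Complex.I * toComplex s := by
  induction p using Polynomial.induction_on' with
  | add p q hp hq =>
    obtain ⟨r, s, rfl⟩ := hp
    obtain ⟨r', s', rfl⟩ := hq
    exact ⟨r + r', s + s', by simp only [map_add]; ring⟩
  | monomial n c =>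
    refine ⟨monomial n c.re, monomial n c.im, ?_⟩
    ext k
    by_cases hk : n = k <;>
      simp [coeff_toComplex, coeff_monomial, hk, mul_comm Complex.I, Complex.re_add_im]

lemma re_unique {p a b : ℝ[X]} (h : toComplex p = toComplex a + C Complex.I * toComplex b) :
    p = a := by
  ext k
  have := congrArg (fun q => (coeff q k).re) h
  simpa [coeff_toComplex] using this

end Jakubovic

open Jakubovic

/-- **Jakubovič.** A univariate symmetric matrix polynomial `f ∈ ℝ[Z]^{t×t}` is positive
semidefinite at every `z ∈ ℝ` if and only if it is a sum of two hermitian squares. -/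
theorem stmt4 (t : ℕ) (f : Matrix (Fin t) (Fin t) (Polynomial ℝ)) (hf : fᵀ = f) :
    (∀ z : ℝ, (f.map (fun q => Polynomial.eval z q)).PosSemidef) ↔
      ∃ g h : Matrix (Fin t) (Fin t) (Polynomial ℝ), f = gᵀ * g + hᵀ * h := by
  constructor
  · intro hpos
    obtain ⟨d, hd, F, hF⟩ := exists_denominator t f hf fun z v => by
      simpa using (hpos z).dotProduct_mulVec_nonneg v
    obtain ⟨G, hG⟩ := exists_hermitian_square_of_smul (toComplex d)
      ((map_ne_zero_iff _ toComplex_injective).mpr hd) F (f.map toComplex) (by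
        rw [← hF, star_toComplex]
        ext1 i j
        simp [sq])
    choose g h hgh using fun i j => exists_re_im (G i j)
    refine ⟨of g, of h, ?_⟩
    ext1 i j
    refine re_unique (b := ∑ k, (g k i * h k j - h k i * g k j)) ?_
    have hI : (Polynomial.C Complex.I) ^ 2 = -1 := by rw [← Polynomial.C_pow]; simp
    have := congrFun (congrFun hG i) j
    simp only [map_apply, Matrix.mul_apply, conjTranspose_apply, hgh, star_add, star_mul,
      star_toComplex, star_C, Complex.star_def, Complex.conj_I, Polynomial.C_neg] at this
    simp only [this, Matrix.add_apply, Matrix.mul_apply, transpose_apply, of_apply, map_add, map_sum,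
      map_sub, map_mul, Finset.mul_sum, ← Finset.sum_add_distrib]
    refine Finset.sum_congr rfl fun k _ => ?_
    linear_combination -(toComplex (h k i) * toComplex (h k j)) * hI
  · rintro ⟨g, h, rfl⟩ z
    have key (a : Matrix (Fin t) (Fin t) (Polynomial ℝ)) :
        ((aᵀ * a).map (Polynomial.evalRingHom z)).PosSemidef := by
      rw [Matrix.map_mul, transpose_map, ← conjTranspose_eq_transpose_of_trivial]
      exact posSemidef_conjTranspose_mul_self _
    have := (key g).add (key h)
    rw [← Matrix.map_add _ (map_add _)] at this
    exact this
end

section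
/- Let G ⊆ Sym ℝ[X₁,…,Xₙ]^{t×t} with M_G archimedean. Then every pure state L on (Sym ℝ[X̄]^{t×t}, M_G) has the form L(p) = ⟨p(x)v, v⟩ for some x ∈ S_G and some unit vector v ∈ ℝᵗ. -/
open Matrix

variable (n t : ℕ)

/-- Membership in the quadratic module `M_G` generated by `G` in `ℝ[X̄]^{t×t}`. -/
def InQM (G : Set (Matrix (Fin t) (Fin t) (MvPolynomial (Fin n) ℝ)))
    (f : Matrix (Fin t) (Fin t) (MvPolynomial (Fin n) ℝ)) : Prop :=
  ∃ (N : ℕ) (g p : Fin N → Matrix (Fin t) (Fin t) (MvPolynomial (Fin n) ℝ)),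
    (∀ i, g i = 1 ∨ g i ∈ G) ∧ f = ∑ i, (p i)ᵀ * g i * p i

/-- The positivity set `S_G ⊆ ℝⁿ`. -/
def SG (G : Set (Matrix (Fin t) (Fin t) (MvPolynomial (Fin n) ℝ))) :
    Set (Fin n → ℝ) :=
  {x | ∀ g ∈ G, (g.map (MvPolynomial.eval x)).PosSemidef}

/-- `M_G` is archimedean. -/
def IsArch (G : Set (Matrix (Fin t) (Fin t) (MvPolynomial (Fin n) ℝ))) : Prop :=
  ∀ a : Matrix (Fin t) (Fin t) (MvPolynomial (Fin n) ℝ),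
    ∃ N : ℕ, InQM n t G ((N : Matrix (Fin t) (Fin t) (MvPolynomial (Fin n) ℝ)) - aᵀ * a)

/-- The real vector space of symmetric matrix polynomials. -/
noncomputable def SymSub : Submodule ℝ (Matrix (Fin t) (Fin t) (MvPolynomial (Fin n) ℝ)) where
  carrier := {p | pᵀ = p}
  add_mem' := by
    intro a b ha hb
    simp only [Set.mem_setOf_eq, Matrix.transpose_add] at *
    rw [ha, hb]
  zero_mem' := by simp
  smul_mem' := by
    intro c a ha
    simp only [Set.mem_setOf_eq, Matrix.transpose_smul] at *
    rw [ha]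

theorem one_mem_SymSub : (1 : Matrix (Fin t) (Fin t) (MvPolynomial (Fin n) ℝ)) ∈ SymSub n t :=
  Matrix.transpose_one

/-- A state on `(Sym ℝ[X̄]^{t×t}, M_G)`. -/
def IsState (G : Set (Matrix (Fin t) (Fin t) (MvPolynomial (Fin n) ℝ)))
    (L : SymSub n t →ₗ[ℝ] ℝ) : Prop :=
  L ⟨1, one_mem_SymSub n t⟩ = 1 ∧
    ∀ (p : Matrix (Fin t) (Fin t) (MvPolynomial (Fin n) ℝ)) (hp : p ∈ SymSub n t),
      InQM n t G p → 0 ≤ L ⟨p, hp⟩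

/-- A pure state: an extreme point of the convex set of states. -/
def IsPure (G : Set (Matrix (Fin t) (Fin t) (MvPolynomial (Fin n) ℝ)))
    (L : SymSub n t →ₗ[ℝ] ℝ) : Prop :=
  IsState n t G L ∧
    ∀ (L₁ L₂ : SymSub n t →ₗ[ℝ] ℝ) (θ : ℝ), IsState n t G L₁ → IsState n t G L₂ →
      0 < θ → θ < 1 → L = θ • L₁ + (1 - θ) • L₂ → L₁ = L ∧ L₂ = L

/-- `L` is the state of point evaluation at `(x, v)`. -/
def Represents (L : SymSub n t →ₗ[ℝ] ℝ) (x : Fin n → ℝ) (v : Fin t → ℝ) : Prop :=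
  ∀ (p : Matrix (Fin t) (Fin t) (MvPolynomial (Fin n) ℝ)) (hp : p ∈ SymSub n t),
    L ⟨p, hp⟩ = dotProduct (Matrix.mulVec (p.map (MvPolynomial.eval x)) v) v

section QuadraticModule

variable {n t : ℕ} {G : Set (Matrix (Fin t) (Fin t) (MvPolynomial (Fin n) ℝ))}
  {f g p : Matrix (Fin t) (Fin t) (MvPolynomial (Fin n) ℝ)}

theorem InQM.add (hf : InQM n t G f) (hg : InQM n t G g) : InQM n t G (f + g) := by
  obtain ⟨N, a, p, ha, rfl⟩ := hf
  obtain ⟨M, b, q, hb, rfl⟩ := hg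
  refine ⟨N + M, Fin.append a b, Fin.append p q, fun i => ?_, ?_⟩
  · induction i using Fin.addCases with
    | left i => simpa using ha i
    | right i => simpa using hb i
  · simp [Fin.sum_univ_add]

theorem InQM.congruence (hf : InQM n t G f)
    (q : Matrix (Fin t) (Fin t) (MvPolynomial (Fin n) ℝ)) : InQM n t G (qᵀ * f * q) := by
  obtain ⟨N, a, p, ha, rfl⟩ := hf
  refine ⟨N, a, fun i => p i * q, ha, ?_⟩
  simp [Matrix.mul_sum, Matrix.sum_mul, Matrix.mul_assoc, Matrix.transpose_mul]

theorem InQM.of_mem (hg : g = 1 ∨ g ∈ G) : InQM n t G g :=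
  ⟨1, fun _ => g, fun _ => 1, fun _ => hg, by simp⟩

theorem inQM_one : InQM n t G 1 := .of_mem (.inl rfl)

theorem inQM_transpose_mul_self (q : Matrix (Fin t) (Fin t) (MvPolynomial (Fin n) ℝ)) :
    InQM n t G (qᵀ * q) := by
  simpa using (inQM_one (G := G)).congruence q

theorem InQM.sq_smul (hf : InQM n t G f) (c : MvPolynomial (Fin n) ℝ) :
    InQM n t G (c ^ 2 • f) := by
  simpa [Matrix.transpose_smul, smul_smul, pow_two] using hf.congruence (c • 1)

theorem InQM.transpose_eq (hG : ∀ g ∈ G, gᵀ = g) (hf : InQM n t G f) : fᵀ = f := by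
  obtain ⟨N, a, p, ha, rfl⟩ := hf
  rw [Matrix.transpose_sum]
  refine Finset.sum_congr rfl fun i _ => ?_
  have h : (a i)ᵀ = a i := by
    rcases ha i with h | h
    · simp [h]
    · exact hG _ h
  simp [Matrix.transpose_mul, h, Matrix.mul_assoc]

theorem IsArch.exists_sub_inQM (harch : IsArch n t G) (hp : pᵀ = p) :
    ∃ N : ℕ, InQM n t G ((N : ℝ) • 1 - p) := by
  obtain ⟨N, hN⟩ := harch ((1 / 2 : ℝ) • p)
  refine ⟨N + 1, ?_⟩
  convert hN.add (inQM_transpose_mul_self ((1 / 2 : ℝ) • p - 1)) using 1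
  have hcast : (N : Matrix (Fin t) (Fin t) (MvPolynomial (Fin n) ℝ)) = (N : ℝ) • 1 := by
    rw [Nat.cast_smul_eq_nsmul, nsmul_one]
  rw [hcast]
  simp only [Matrix.transpose_smul, Matrix.transpose_sub, Matrix.transpose_one, hp,
    sub_mul, mul_sub, mul_one, one_mul]
  push_cast
  module

/-- Symmetric linear forms on `ℝ[X̄]^{t×t}` that are nonnegative on `M_G`. -/
def IsPosForm (G : Set (Matrix (Fin t) (Fin t) (MvPolynomial (Fin n) ℝ)))
    (Φ : Matrix (Fin t) (Fin t) (MvPolynomial (Fin n) ℝ) →ₗ[ℝ] ℝ) : Prop :=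
  (∀ a, Φ aᵀ = Φ a) ∧ ∀ f, InQM n t G f → 0 ≤ Φ f

/-- The projection of `ℝ[X̄]^{t×t}` onto its symmetric part. -/
noncomputable def symPart :
    Matrix (Fin t) (Fin t) (MvPolynomial (Fin n) ℝ) →ₗ[ℝ] SymSub n t where
  toFun a := ⟨(1 / 2 : ℝ) • (a + aᵀ), by
    change ((1 / 2 : ℝ) • (a + aᵀ))ᵀ = (1 / 2 : ℝ) • (a + aᵀ)
    simp [add_comm]⟩
  map_add' a b := by
    ext1
    simp only [Matrix.transpose_add, Submodule.coe_add]
    module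
  map_smul' c a := by
    ext1
    simp only [Matrix.transpose_smul, Submodule.coe_smul, RingHom.id_apply]
    module

theorem symPart_transpose (a : Matrix (Fin t) (Fin t) (MvPolynomial (Fin n) ℝ)) :
    symPart aᵀ = symPart a := by
  ext1
  simp [symPart, add_comm]

theorem symPart_coe (p : SymSub n t) : symPart (p : Matrix _ _ _) = p := by
  ext1
  have hp : (p : Matrix (Fin t) (Fin t) (MvPolynomial (Fin n) ℝ))ᵀ = p := p.2
  simp only [symPart, LinearMap.coe_mk, AddHom.coe_mk, hp]
  module

namespace IsPosForm

variable {Φ Ψ : Matrix (Fin t) (Fin t) (MvPolynomial (Fin n) ℝ) →ₗ[ℝ] ℝ}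

theorem apply_symPart (hΦ : IsPosForm G Φ)
    (a : Matrix (Fin t) (Fin t) (MvPolynomial (Fin n) ℝ)) :
    Φ (symPart a : Matrix _ _ _) = Φ a := by
  simp only [symPart, LinearMap.coe_mk, AddHom.coe_mk, map_smul, map_add, hΦ.1, smul_eq_mul]
  ring

theorem eq_zero (hΦ : IsPosForm G Φ) (harch : IsArch n t G) (h1 : Φ 1 = 0) : Φ = 0 := by
  have hle : ∀ p : Matrix (Fin t) (Fin t) (MvPolynomial (Fin n) ℝ), pᵀ = p → Φ p ≤ 0 := by
    intro p hp
    obtain ⟨N, hN⟩ := harch.exists_sub_inQM hp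
    simpa [h1] using hΦ.2 _ hN
  ext1 a
  have hs : ((symPart a : SymSub n t) : Matrix (Fin t) (Fin t) (MvPolynomial (Fin n) ℝ))ᵀ =
      symPart a := (symPart a).2
  have hneg := hle (-(symPart a : SymSub n t)) (by rw [Matrix.transpose_neg, hs])
  have := hle _ hs
  rw [map_neg, hΦ.apply_symPart] at hneg
  rw [hΦ.apply_symPart] at this
  exact le_antisymm this (neg_nonpos.1 hneg)

theorem one_nonneg (hΦ : IsPosForm G Φ) : 0 ≤ Φ 1 := hΦ.2 _ inQM_one

theorem smul (hΦ : IsPosForm G Φ) {c : ℝ} (hc : 0 ≤ c) : IsPosForm G (c • Φ) :=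
  ⟨fun a => by simp [hΦ.1], fun f hf => mul_nonneg hc (hΦ.2 f hf)⟩

theorem isState_normalize (hΦ : IsPosForm G Φ) (h1 : 0 < Φ 1) :
    IsState n t G ((Φ 1)⁻¹ • Φ ∘ₗ (SymSub n t).subtype) := by
  refine ⟨?_, fun p hp hq => ?_⟩
  · simp [h1.ne']
  · exact mul_nonneg (inv_nonneg.2 h1.le) (hΦ.2 p hq)

end IsPosForm

theorem IsState.isPosForm (hG : ∀ g ∈ G, gᵀ = g) {L : SymSub n t →ₗ[ℝ] ℝ}
    (hL : IsState n t G L) : IsPosForm G (L ∘ₗ symPart) := by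
  refine ⟨fun a => by simp [symPart_transpose], fun f hf => ?_⟩
  have h := symPart_coe (⟨f, hf.transpose_eq hG⟩ : SymSub n t)
  simp only at h
  rw [LinearMap.comp_apply, h]
  exact hL.2 f _ hf

theorem IsState.comp_symPart_one {L : SymSub n t →ₗ[ℝ] ℝ} (hL : IsState n t G L) :
    (L ∘ₗ symPart) 1 = 1 := by
  rw [LinearMap.comp_apply, ← hL.1]
  exact congrArg L (symPart_coe ⟨1, one_mem_SymSub n t⟩)

/-- A positive form dominated by a pure state is a multiple of it. -/
theorem IsPure.eq_smul_of_dominated (harch : IsArch n t G)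
    {L : SymSub n t →ₗ[ℝ] ℝ} (hL : IsPure n t G L)
    {Φ : Matrix (Fin t) (Fin t) (MvPolynomial (Fin n) ℝ) →ₗ[ℝ] ℝ} (hΦ : IsPosForm G Φ)
    (hd : IsPosForm G (L ∘ₗ symPart - Φ)) : Φ = Φ 1 • L ∘ₗ symPart := by
  have hd1 : (L ∘ₗ symPart - Φ) 1 = 1 - Φ 1 := by
    rw [LinearMap.sub_apply, hL.1.comp_symPart_one]
  rcases hΦ.one_nonneg.eq_or_lt with h0 | h0
  · rw [← h0, zero_smul]
    exact hΦ.eq_zero harch h0.symm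
  have hle := hd.one_nonneg
  rcases hle.eq_or_lt with h1 | h1
  · have := hd.eq_zero harch h1.symm
    rw [show Φ 1 = 1 by linarith, one_smul, ← sub_eq_zero.1 this]
  have hstate := hL.2 _ _ (Φ 1) (hΦ.isState_normalize h0) (hd.isState_normalize h1) h0
    (by linarith) (by
      rw [hd1, smul_smul, smul_smul, mul_inv_cancel₀ h0.ne',
        mul_inv_cancel₀ (by rw [← hd1]; exact h1.ne'), one_smul, one_smul]
      ext p
      simp [symPart_coe])
  ext1 a
  rw [← hstate.1]
  have := hΦ.apply_symPart a
  simp [h0.ne', this]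

/-- If a sequence that is log-convex in the sense below is bounded by a geometric sequence of
ratio `N`, then its first ratio is at most `N`. -/
theorem le_mul_of_logConvex_of_le_geometric {m : ℕ → ℝ} {C N : ℝ} (hN : 0 < N)
    (h0 : 0 ≤ m 0) (hconv : ∀ k, m (k + 1) ^ 2 ≤ m k * m (k + 2))
    (hbound : ∀ k, m k ≤ C * N ^ k) : m 1 ≤ N * m 0 := by
  by_contra! hlt
  have hm0 : 0 < m 0 := by
    refine h0.lt_of_ne fun h => ?_
    have := hconv 0
    rw [← h] at this hlt
    simp only [zero_add, zero_mul, mul_zero] at this hlt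
    nlinarith
  set r := m 1 / m 0
  have hr : N < r := by rwa [lt_div_iff₀ hm0]
  have hr0 : 0 < r := hN.trans hr
  have hstep : ∀ k, 0 < m k ∧ r * m k ≤ m (k + 1) := by
    intro k
    induction k with
    | zero => exact ⟨hm0, (div_mul_cancel₀ _ hm0.ne').le⟩
    | succ k ih =>
      have hpos : 0 < m (k + 1) := (mul_pos hr0 ih.1).trans_le ih.2
      refine ⟨hpos, ?_⟩
      have hc := hconv k
      have : m k * (r * m (k + 1)) ≤ m k * m (k + 2) := by nlinarith [ih.2]
      exact le_of_mul_le_mul_left this ih.1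
  have hgeom : ∀ k, r ^ k * m 0 ≤ m k := by
    intro k
    induction k with
    | zero => simp
    | succ k ih =>
      calc r ^ (k + 1) * m 0 = r * (r ^ k * m 0) := by ring
        _ ≤ r * m k := by gcongr
        _ ≤ m (k + 1) := (hstep k).2
  obtain ⟨k, hk⟩ := pow_unbounded_of_one_lt (C / m 0) ((one_lt_div hN).2 hr)
  have h1 := (hgeom k).trans (hbound k)
  rw [div_pow, div_lt_div_iff₀ hm0 (by positivity)] at hk
  linarith

namespace IsPosForm

variable {Φ : Matrix (Fin t) (Fin t) (MvPolynomial (Fin n) ℝ) →ₗ[ℝ] ℝ}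

theorem pow_smul_one_le (hΦ : IsPosForm G Φ) {c : MvPolynomial (Fin n) ℝ} {N : ℝ}
    (hN : 0 ≤ N) (hc : InQM n t G (N • 1 - c ^ 2 • 1)) (k : ℕ) :
    Φ ((c ^ k) ^ 2 • 1) ≤ Φ 1 * N ^ k := by
  induction k with
  | zero => simp
  | succ k ih =>
    have h := hΦ.2 _ (hc.sq_smul (c ^ k))
    rw [smul_sub, smul_smul, smul_comm, map_sub, map_smul, sub_nonneg, smul_eq_mul,
      ← mul_pow, ← pow_succ] at h
    calc Φ ((c ^ (k + 1)) ^ 2 • 1) ≤ N * Φ ((c ^ k) ^ 2 • 1) := h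
      _ ≤ N * (Φ 1 * N ^ k) := by gcongr
      _ = Φ 1 * N ^ (k + 1) := by ring

theorem sq_smul_le (hG : ∀ g ∈ G, gᵀ = g) (harch : IsArch n t G) (hΦ : IsPosForm G Φ)
    {c : MvPolynomial (Fin n) ℝ} {N : ℝ} (hN : 0 < N)
    (hc : InQM n t G (N • 1 - c ^ 2 • 1)) (hp : InQM n t G p) :
    Φ (c ^ 2 • p) ≤ N * Φ p := by
  obtain ⟨C, hC⟩ := harch.exists_sub_inQM (hp.transpose_eq hG)
  have key := le_mul_of_logConvex_of_le_geometric (m := fun k => Φ ((c ^ k) ^ 2 • p))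
    (C := C * Φ 1) hN (by simpa using hΦ.2 _ hp) ?_ ?_
  · simpa using key
  · intro k
    have hquad : ∀ s : ℝ, 0 ≤ Φ ((c ^ k) ^ 2 • p) * (s * s) +
        (-2 * Φ ((c ^ (k + 1)) ^ 2 • p)) * s + Φ ((c ^ (k + 2)) ^ 2 • p) := by
      intro s
      have h := hΦ.2 _ (hp.sq_smul (c ^ k * (MvPolynomial.C s - c ^ 2)))
      have he : (c ^ k * (MvPolynomial.C s - c ^ 2)) ^ 2 • p =
          (s * s) • ((c ^ k) ^ 2 • p) + (-2 * s) • ((c ^ (k + 1)) ^ 2 • p) +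
            (c ^ (k + 2)) ^ 2 • p := by
        ext1 i j
        simp only [Matrix.smul_apply, Matrix.add_apply, smul_eq_mul, MvPolynomial.smul_eq_C_mul,
          map_mul, map_neg, map_ofNat]
        ring
      rw [he, map_add, map_add, Φ.map_smul (s * s), Φ.map_smul (-2 * s), smul_eq_mul,
        smul_eq_mul] at h
      linarith
    have := discrim_le_zero hquad
    rw [discrim] at this
    linarith
  · intro k
    have h := hΦ.2 _ (hC.sq_smul (c ^ k))
    rw [smul_sub, smul_comm, map_sub, map_smul, sub_nonneg, smul_eq_mul] at h
    calc Φ ((c ^ k) ^ 2 • p) ≤ C * Φ ((c ^ k) ^ 2 • 1) := h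
      _ ≤ C * (Φ 1 * N ^ k) := by gcongr; exact hΦ.pow_smul_one_le hN.le hc k
      _ = C * Φ 1 * N ^ k := by ring

end IsPosForm

theorem IsPure.apply_sq_smul (hG : ∀ g ∈ G, gᵀ = g) (harch : IsArch n t G)
    {L : SymSub n t →ₗ[ℝ] ℝ} (hL : IsPure n t G L) (c : MvPolynomial (Fin n) ℝ)
    (a : Matrix (Fin t) (Fin t) (MvPolynomial (Fin n) ℝ)) :
    (L ∘ₗ symPart) (c ^ 2 • a) = (L ∘ₗ symPart) (c ^ 2 • 1) * (L ∘ₗ symPart) a := by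
  have hΦ := hL.1.isPosForm hG
  set Φ := L ∘ₗ symPart with hΦdef
  obtain ⟨M, hM⟩ := harch.exists_sub_inQM (p := c ^ 2 • 1) (by simp)
  obtain ⟨N, hN, hc⟩ : ∃ N : ℝ, 0 < N ∧ InQM n t G (N • 1 - c ^ 2 • 1) := by
    refine ⟨M + 1, by positivity, ?_⟩
    convert hM.add inQM_one using 1
    module
  let Ψ : Matrix (Fin t) (Fin t) (MvPolynomial (Fin n) ℝ) →ₗ[ℝ] ℝ :=
    Φ ∘ₗ (LinearMap.lsmul (MvPolynomial (Fin n) ℝ) _ (c ^ 2)).restrictScalars ℝ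
  have hΨ : ∀ b, Ψ b = Φ (c ^ 2 • b) := fun b => rfl
  have hpos : IsPosForm G Ψ :=
    ⟨fun b => by rw [hΨ, hΨ, ← Matrix.transpose_smul, hΦ.1],
      fun f hf => hΦ.2 _ (hf.sq_smul c)⟩
  have hdom : IsPosForm G (Φ - N⁻¹ • Ψ) := by
    refine ⟨fun b => by simp [hΦ.1, hpos.1], fun f hf => ?_⟩
    have := hΦ.sq_smul_le hG harch hN hc hf
    rw [LinearMap.sub_apply, LinearMap.smul_apply, hΨ, smul_eq_mul, sub_nonneg,
      inv_mul_le_iff₀ hN]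
    exact this
  have h := congrArg (fun F => F a) (hL.eq_smul_of_dominated harch
    (hpos.smul (inv_nonneg.2 hN.le)) hdom)
  simp only [LinearMap.smul_apply, smul_eq_mul, hΨ, ← hΦdef, mul_assoc] at h
  exact mul_left_cancel₀ (inv_ne_zero hN.ne') h

theorem IsPure.apply_smul (hG : ∀ g ∈ G, gᵀ = g) (harch : IsArch n t G)
    {L : SymSub n t →ₗ[ℝ] ℝ} (hL : IsPure n t G L) (c : MvPolynomial (Fin n) ℝ)
    (a : Matrix (Fin t) (Fin t) (MvPolynomial (Fin n) ℝ)) :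
    (L ∘ₗ symPart) (c • a) = (L ∘ₗ symPart) (c • 1) * (L ∘ₗ symPart) a := by
  have h1 := hL.apply_sq_smul hG harch (c + 1) a
  have h2 := hL.apply_sq_smul hG harch (c - 1) a
  have hp : ∀ b : Matrix (Fin t) (Fin t) (MvPolynomial (Fin n) ℝ),
      (c + 1) ^ 2 • b = (c - 1) ^ 2 • b + (4 : ℝ) • (c • b) := by
    intro b
    ext1 i j
    simp only [Matrix.smul_apply, Matrix.add_apply, smul_eq_mul, MvPolynomial.smul_eq_C_mul,
      map_ofNat]
    ring
  rw [hp, hp, map_add, map_add, LinearMap.map_smul _ (4 : ℝ), LinearMap.map_smul _ (4 : ℝ), h2,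
    smul_eq_mul, smul_eq_mul] at h1
  linarith

/-- A pure state factors through the evaluation at some point. -/
theorem IsPure.exists_eval (hG : ∀ g ∈ G, gᵀ = g) (harch : IsArch n t G)
    {L : SymSub n t →ₗ[ℝ] ℝ} (hL : IsPure n t G L) :
    ∃ x : Fin n → ℝ, ∀ a : Matrix (Fin t) (Fin t) (MvPolynomial (Fin n) ℝ),
      (L ∘ₗ symPart) a =
        ∑ i, ∑ j, MvPolynomial.eval x (a i j) * (L ∘ₗ symPart) (single i j 1) := by
  have hmul := hL.apply_smul hG harch
  have hone := hL.1.comp_symPart_one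
  set Φ := L ∘ₗ symPart with hΦdef
  let χ : MvPolynomial (Fin n) ℝ →ₐ[ℝ] ℝ := AlgHom.ofLinearMap
    (Φ ∘ₗ (LinearMap.toSpanSingleton (MvPolynomial (Fin n) ℝ) _ 1).restrictScalars ℝ)
    (by simpa using hone) (fun c d => by
      simpa [smul_smul] using hmul c (d • 1))
  have hχ : ∀ c, Φ (c • 1) = MvPolynomial.eval (χ ∘ MvPolynomial.X) c := by
    intro c
    rw [← MvPolynomial.coe_aeval_eq_eval, RingHom.coe_coe, ← MvPolynomial.aeval_unique χ]
    rfl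
  refine ⟨χ ∘ MvPolynomial.X, fun a => ?_⟩
  conv_lhs => rw [matrix_eq_sum_single a]
  simp only [map_sum]
  refine Finset.sum_congr rfl fun i _ => Finset.sum_congr rfl fun j _ => ?_
  rw [← hχ, ← hmul]
  simp [Matrix.smul_single]

theorem InQM.posSemidef_eval (hf : InQM n t G f) {x : Fin n → ℝ} (hx : x ∈ SG n t G) :
    (f.map (MvPolynomial.eval x)).PosSemidef := by
  obtain ⟨N, a, p, ha, rfl⟩ := hf
  have hmap : (∑ i, (p i)ᵀ * a i * p i).map (MvPolynomial.eval x) =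
      ∑ i, ((p i).map (MvPolynomial.eval x))ᴴ * (a i).map (MvPolynomial.eval x) *
        (p i).map (MvPolynomial.eval x) := by
    simp only [← RingHom.mapMatrix_apply, map_sum, map_mul]
    simp [Matrix.conjTranspose_eq_transpose_of_trivial, Matrix.transpose_map]
  rw [hmap]
  refine Matrix.posSemidef_sum _ fun i _ => ?_
  refine Matrix.PosSemidef.conjTranspose_mul_mul_same ?_ _
  rcases ha i with h | h
  · rw [h, ← RingHom.mapMatrix_apply, map_one]
    exact Matrix.PosSemidef.one
  · exact hx _ h

theorem Matrix.PosSemidef.sum_mul_nonneg {ι : Type*} [Fintype ι] {A B : Matrix ι ι ℝ}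
    (hA : A.PosSemidef) (hB : B.PosSemidef) : 0 ≤ ∑ i, ∑ j, A i j * B i j := by
  have h := (hA.hadamard hB).dotProduct_mulVec_nonneg 1
  simpa [dotProduct, mulVec, Matrix.hadamard_apply] using h

/-- Subtracting from a positive semidefinite matrix the rank one matrix determined by its
`i`-th row leaves a positive semidefinite matrix. -/
theorem posSemidef_sub_smul_vecMulVec {ι : Type*} [Fintype ι] {ρ : Matrix ι ι ℝ}
    (hρ : ρ.PosSemidef) {i : ι} (hi : 0 < ρ i i) :
    (ρ - (ρ i i)⁻¹ • vecMulVec (ρ i) (ρ i)).PosSemidef := by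
  classical
  have hT : ρᵀ = ρ := by simpa [Matrix.conjTranspose_eq_transpose_of_trivial] using hρ.1.eq
  refine .of_dotProduct_mulVec_nonneg ?_ fun y => ?_
  · rw [Matrix.IsHermitian, Matrix.conjTranspose_eq_transpose_of_trivial]
    simp [Matrix.transpose_sub, Matrix.transpose_smul, hT, Matrix.transpose_vecMulVec]
  · set s := ρ i ⬝ᵥ y with hs
    have h := hρ.dotProduct_mulVec_nonneg (y - Pi.single i ((ρ i i)⁻¹ * s))
    have h1 : ∀ c : ℝ, y ⬝ᵥ ρ *ᵥ Pi.single i c = c * s := by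
      intro c
      rw [dotProduct_mulVec, ← mulVec_transpose, hT, dotProduct_single]
      simp [mulVec, hs, mul_comm]
    have h2 : ∀ c : ℝ, Pi.single i c ⬝ᵥ ρ *ᵥ y = c * s := by
      intro c
      simp [mulVec, hs]
    have h3 : ∀ c : ℝ, Pi.single i c ⬝ᵥ ρ *ᵥ Pi.single i c = c * (c * ρ i i) := by
      intro c
      simp
    have h4 : y ⬝ᵥ vecMulVec (ρ i) (ρ i) *ᵥ y = s * s := by
      rw [vecMulVec_mulVec, dotProduct_smul, dotProduct_comm y]
      simp [hs]
    simp only [star_trivial, mulVec_sub, sub_dotProduct, dotProduct_sub, h1, h2, h3] at h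
    simp only [star_trivial, sub_mulVec, dotProduct_sub, smul_mulVec, dotProduct_smul, h4,
      smul_eq_mul]
    have : (ρ i i)⁻¹ * s * ((ρ i i)⁻¹ * s * ρ i i) = (ρ i i)⁻¹ * s * s := by
      field_simp
    rw [this] at h
    linarith

/-- The linear form `p ↦ ⟨p(x)u, u⟩`. -/
noncomputable def evalForm (x : Fin n → ℝ) (u : Fin t → ℝ) :
    Matrix (Fin t) (Fin t) (MvPolynomial (Fin n) ℝ) →ₗ[ℝ] ℝ where
  toFun p := p.map (MvPolynomial.eval x) *ᵥ u ⬝ᵥ u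
  map_add' a b := by simp [Matrix.map_add, add_mulVec, add_dotProduct]
  map_smul' c a := by
    have : (c • a).map (MvPolynomial.eval x) = c • a.map (MvPolynomial.eval x) := by
      ext i j
      simp [MvPolynomial.smul_eval]
    simp [this, smul_mulVec, smul_dotProduct]

theorem evalForm_apply (x : Fin n → ℝ) (u : Fin t → ℝ)
    (p : Matrix (Fin t) (Fin t) (MvPolynomial (Fin n) ℝ)) :
    evalForm x u p = p.map (MvPolynomial.eval x) *ᵥ u ⬝ᵥ u := rfl

theorem evalForm_eq_sum (x : Fin n → ℝ) (u : Fin t → ℝ)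
    (p : Matrix (Fin t) (Fin t) (MvPolynomial (Fin n) ℝ)) :
    evalForm x u p = ∑ i, ∑ j, MvPolynomial.eval x (p i j) * vecMulVec u u i j := by
  simp only [evalForm_apply, dotProduct, mulVec, Finset.sum_mul, vecMulVec_apply, Matrix.map_apply]
  exact Finset.sum_congr rfl fun i _ => Finset.sum_congr rfl fun j _ => by ring

theorem evalForm_one (x : Fin n → ℝ) (u : Fin t → ℝ) : evalForm x u 1 = u ⬝ᵥ u := by
  rw [evalForm_apply, ← RingHom.mapMatrix_apply, map_one, one_mulVec]

theorem isPosForm_evalForm {x : Fin n → ℝ} (hx : x ∈ SG n t G) (u : Fin t → ℝ) :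
    IsPosForm G (evalForm x u) := by
  refine ⟨fun a => ?_, fun f hf => ?_⟩
  · rw [evalForm_apply, evalForm_apply, Matrix.transpose_map, mulVec_transpose,
      ← dotProduct_mulVec, dotProduct_comm]
  · rw [evalForm_apply, dotProduct_comm]
    exact (hf.posSemidef_eval hx).dotProduct_mulVec_nonneg u

section Factorization

variable {Φ : Matrix (Fin t) (Fin t) (MvPolynomial (Fin n) ℝ) →ₗ[ℝ] ℝ} {x : Fin n → ℝ}
  {ρ : Matrix (Fin t) (Fin t) ℝ}

theorem apply_rankOne_congruence
    (hx : ∀ a, Φ a = ∑ i, ∑ j, MvPolynomial.eval x (a i j) * ρ i j)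
    (g : Matrix (Fin t) (Fin t) (MvPolynomial (Fin n) ℝ)) (u w : Fin t → ℝ) :
    Φ (((vecMulVec u w).map MvPolynomial.C)ᵀ * g * (vecMulVec u w).map MvPolynomial.C) =
      (u ⬝ᵥ g.map (MvPolynomial.eval x) *ᵥ u) * (w ⬝ᵥ ρ *ᵥ w) := by
  have he : (((vecMulVec u w).map MvPolynomial.C)ᵀ * g *
      (vecMulVec u w).map MvPolynomial.C).map (MvPolynomial.eval x) =
        (u ⬝ᵥ g.map (MvPolynomial.eval x) *ᵥ u) • vecMulVec w w := by
    have hC : ∀ u w : Fin t → ℝ,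
        ((vecMulVec u w).map MvPolynomial.C).map (MvPolynomial.eval x) = vecMulVec u w := by
      intro u w
      ext i j
      simp [vecMulVec_apply]
    rw [← RingHom.mapMatrix_apply, map_mul, map_mul]
    simp only [RingHom.mapMatrix_apply, ← Matrix.transpose_map, hC, transpose_vecMulVec]
    rw [vecMulVec_mul, vecMulVec_mul_vecMulVec, ← dotProduct_mulVec]
    ext i j
    simp [vecMulVec_apply]
    ring
  have hij := fun i j => congrFun (congrFun he i) j
  simp only [Matrix.map_apply, Matrix.smul_apply, vecMulVec_apply, smul_eq_mul] at hij
  rw [hx]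
  simp only [hij]
  simp only [mul_assoc, ← Finset.mul_sum]
  simp [dotProduct, mulVec, Finset.mul_sum, mul_left_comm, mul_comm]

theorem IsPosForm.posSemidef_density (hΦ : IsPosForm G Φ) (hΦ1 : Φ 1 = 1)
    (hx : ∀ a, Φ a = ∑ i, ∑ j, MvPolynomial.eval x (a i j) * ρ i j) (hρ : ρᵀ = ρ) :
    ρ.PosSemidef ∧ ∃ i, 0 < ρ i i := by
  have htr : ∑ i, ρ i i = 1 := by
    rw [← hΦ1, hx]
    refine Finset.sum_congr rfl fun i _ => ?_
    rw [Finset.sum_eq_single i]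
    · simp
    · intro j _ hj
      simp [Matrix.one_apply_ne hj.symm]
    · simp
  obtain ⟨i, -, hi⟩ : ∃ i ∈ Finset.univ, 0 < ρ i i := by
    apply Finset.exists_lt_of_sum_lt
    simp [htr]
  refine ⟨.of_dotProduct_mulVec_nonneg ?_ fun w => ?_, i, hi⟩
  · rwa [Matrix.IsHermitian, Matrix.conjTranspose_eq_transpose_of_trivial]
  · have h := hΦ.2 _ ((inQM_one (G := G)).congruence
      ((vecMulVec (Pi.single i 1) w).map MvPolynomial.C))
    rw [apply_rankOne_congruence hx, ← RingHom.mapMatrix_apply, map_one] at h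
    simpa using h

theorem IsPosForm.mem_SG (hG : ∀ g ∈ G, gᵀ = g) (hΦ : IsPosForm G Φ)
    (hx : ∀ a, Φ a = ∑ i, ∑ j, MvPolynomial.eval x (a i j) * ρ i j)
    {i : Fin t} (hi : 0 < ρ i i) : x ∈ SG n t G := by
  intro g hg
  refine .of_dotProduct_mulVec_nonneg ?_ fun u => ?_
  · rw [Matrix.IsHermitian, Matrix.conjTranspose_eq_transpose_of_trivial,
      ← Matrix.transpose_map, hG g hg]
  · have h := hΦ.2 _ ((InQM.of_mem (.inr hg)).congruence
      ((vecMulVec u (Pi.single i 1)).map MvPolynomial.C))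
    rw [apply_rankOne_congruence hx] at h
    have hii : Pi.single i 1 ⬝ᵥ ρ *ᵥ Pi.single i 1 = ρ i i := by simp
    rw [hii] at h
    exact nonneg_of_mul_nonneg_left h hi

end Factorization

end QuadraticModule

/-- **Theorem 8.** If `M_G` is archimedean, every pure state on `(Sym ℝ[X̄]^{t×t}, M_G)` is
of the form `p ↦ ⟨p(x)v, v⟩` for some `x ∈ S_G` and unit vector `v ∈ ℝᵗ`. -/
theorem stmt10 (G : Set (Matrix (Fin t) (Fin t) (MvPolynomial (Fin n) ℝ)))
    (hG : ∀ g ∈ G, gᵀ = g) (harch : IsArch n t G)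
    (L : SymSub n t →ₗ[ℝ] ℝ) (hL : IsPure n t G L) :
    ∃ x ∈ SG n t G, ∃ v : Fin t → ℝ, dotProduct v v = 1 ∧ Represents n t L x v := by
  have hΦ := hL.1.isPosForm hG
  have hΦ1 := hL.1.comp_symPart_one
  obtain ⟨x, hx⟩ := hL.exists_eval hG harch
  have hdom := fun Ψ => hL.eq_smul_of_dominated (Φ := Ψ) harch
  have hLΦ : ∀ p : SymSub n t, L p = (L ∘ₗ symPart) p := fun p => by
    rw [LinearMap.comp_apply, symPart_coe]
  set Φ := L ∘ₗ symPart
  let ρ : Matrix (Fin t) (Fin t) ℝ := Matrix.of fun i j => Φ (single i j 1)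
  have hρT : ρᵀ = ρ := by
    ext i j
    simp [ρ, ← hΦ.1 (single i j 1)]
  replace hx : ∀ a, Φ a = ∑ i, ∑ j, MvPolynomial.eval x (a i j) * ρ i j := hx
  obtain ⟨hρ, i, hi⟩ := hΦ.posSemidef_density hΦ1 hx hρT
  have hxG := hΦ.mem_SG hG hx hi
  set u : Fin t → ℝ := (√(ρ i i))⁻¹ • ρ i
  have huu : vecMulVec u u = (ρ i i)⁻¹ • vecMulVec (ρ i) (ρ i) := by
    rw [smul_vecMulVec, vecMulVec_smul, smul_smul, ← mul_inv, Real.mul_self_sqrt hi.le]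
  have hpos := isPosForm_evalForm hxG u
  have hsub : IsPosForm G (Φ - evalForm x u) := by
    refine ⟨fun a => by simp [hΦ.1, hpos.1], fun f hf => ?_⟩
    have h := (hf.posSemidef_eval hxG).sum_mul_nonneg
      (posSemidef_sub_smul_vecMulVec hρ hi)
    rw [← huu] at h
    simpa [LinearMap.sub_apply, hx, evalForm_eq_sum, mul_sub] using h
  have heq := hdom _ hpos hsub
  rw [evalForm_one] at heq
  have h0 : u i ≠ 0 := by
    simp [u, hi.ne', (Real.sqrt_pos.2 hi).ne']
  clear_value u
  have hu : 0 < u ⬝ᵥ u :=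
    (Finset.sum_pos' (fun j _ => mul_self_nonneg (u j))
      ⟨i, Finset.mem_univ i, mul_self_pos.2 h0⟩)
  have hsq : (√(u ⬝ᵥ u))⁻¹ * (√(u ⬝ᵥ u))⁻¹ = (u ⬝ᵥ u)⁻¹ := by
    rw [← mul_inv, Real.mul_self_sqrt hu.le]
  refine ⟨x, hxG, (√(u ⬝ᵥ u))⁻¹ • u, ?_, fun p hp => ?_⟩
  · rw [smul_dotProduct, dotProduct_smul, smul_smul, hsq, smul_eq_mul, inv_mul_cancel₀ hu.ne']
  · have h := congrArg (fun F => F p) heq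
    simp only [LinearMap.smul_apply, smul_eq_mul] at h
    rw [mulVec_smul, smul_dotProduct, dotProduct_smul, smul_smul, hsq, ← evalForm_apply, h,
      hLΦ ⟨p, hp⟩, smul_eq_mul, inv_mul_cancel_left₀ hu.ne']
end
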